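/- Let H = {γ ∈ Δ⁺ : (γ, θ) > 0}. Then the rootlet map τ restricts to a bijection from the set of nonempty abelian ideals contained in H onto the set Δ⁺_l of long positive roots. In particular, the number of nonempty abelian ideals contained in H equals #(Δ⁺_l). -/

import Mathlib

open scoped BigOperators

/-- Data of a reduced irreducible crystallographic root system `Δ`, spanning a
`ℚ`-vector space `V` equipped with a Weyl-group-invariant inner product `B`,
together with a chosen system of positive roots `Pos` and the highest root `θ`. -/
structure RootSystemCtx (V : Type*) [AddCommGroup V] [Module ℚ V] where
  /-- the invariant inner product `( , )` -/
  B : V →ₗ[ℚ] V →ₗ[ℚ] ℚ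
  B_symm : ∀ x y : V, B x y = B y x
  B_posdef : ∀ x : V, x ≠ 0 → 0 < B x x
  /-- the set of roots -/
  Δ : Set V
  Δ_finite : Δ.Finite
  Δ_spans : Submodule.span ℚ Δ = ⊤
  zero_notMem_Δ : (0 : V) ∉ Δ
  neg_mem_Δ : ∀ α ∈ Δ, -α ∈ Δ
  reduced : ∀ α ∈ Δ, ∀ c : ℚ, c • α ∈ Δ → c = 1 ∨ c = -1
  crystallographic : ∀ α ∈ Δ, ∀ β ∈ Δ, ∃ n : ℤ, 2 * B α β / B β β = (n : ℚ)
  reflect_mem : ∀ α ∈ Δ, ∀ β ∈ Δ, β - (2 * B β α / B α α) • α ∈ Δ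
  irreducible : ∀ S : Set V, S ⊆ Δ → (∀ α ∈ S, ∀ β ∈ Δ \ S, B α β = 0) → S = ∅ ∨ S = Δ
  /-- the positive roots `Δ⁺` -/
  Pos : Set V
  pos_subset : Pos ⊆ Δ
  mem_pos_or_neg_pos : ∀ α ∈ Δ, α ∈ Pos ∨ -α ∈ Pos
  pos_not_neg : ∀ α ∈ Pos, -α ∉ Pos
  add_pos_mem : ∀ α ∈ Pos, ∀ β ∈ Pos, α + β ∈ Δ → α + β ∈ Pos
  /-- the highest root `θ` -/
  θ : V
  θ_pos : θ ∈ Pos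
  θ_highest : ∀ ν ∈ Δ, θ - ν ∈ AddSubmonoid.closure Pos

namespace RootSystemCtx

variable {V : Type*} [AddCommGroup V] [Module ℚ V] (ctx : RootSystemCtx V)

/-- the simple roots `Π`: indecomposable positive roots -/
def simple : Set V :=
  {α | α ∈ ctx.Pos ∧ ¬∃ β ∈ ctx.Pos, ∃ γ ∈ ctx.Pos, α = β + γ}

/-- `ρ`, the half-sum of all positive roots -/
noncomputable def ρ : V :=
  (1 / 2 : ℚ) • ∑ α ∈ (ctx.Δ_finite.subset ctx.pos_subset).toFinset, α

/-- the coroot `μ∨ = 2μ/(μ,μ)` -/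
noncomputable def coroot (μ : V) : V := (2 / ctx.B μ μ) • μ

/-- `Δ⁺_l`, the long positive roots (roots of the same length as `θ`) -/
def PosLong : Set V := {μ | μ ∈ ctx.Pos ∧ ctx.B μ μ = ctx.B ctx.θ ctx.θ}

/-- `Π_l`, the long simple roots -/
def SimpleLong : Set V := {μ | μ ∈ ctx.simple ∧ ctx.B μ μ = ctx.B ctx.θ ctx.θ}

/-- the dominance order `μ ≼ ν` on the root lattice: `ν - μ` is a nonnegative
integer combination of positive roots -/
def le (μ ν : V) : Prop := ν - μ ∈ AddSubmonoid.closure ctx.Pos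

/-- a (combinatorial) abelian ideal of `Δ⁺` -/
def IsAbelianIdeal (I : Set V) : Prop :=
  I ⊆ ctx.Pos ∧ (∀ μ ∈ I, ∀ ν ∈ I, μ + ν ∉ ctx.Δ) ∧
    ∀ γ ∈ I, ∀ ν ∈ ctx.Pos, γ + ν ∈ ctx.Δ → γ + ν ∈ I

/-- `γ` is a generator of the ideal `I` -/
def IsGenerator (I : Set V) (γ : V) : Prop := γ ∈ I ∧ ∀ α ∈ ctx.Pos, γ - α ∉ I

/-! ### The affine picture: `V̂ = V ⊕ ℚδ ⊕ ℚλ`, modelled as `V × ℚ × ℚ`,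
with `δ = (0,1,0)` and `λ = (0,0,1)`. -/

/-- the embedding of `V` into `V̂` -/
def emb (_ctx : RootSystemCtx V) (v : V) : V × ℚ × ℚ := (v, 0, 0)

/-- the imaginary root `δ` -/
def δhat (_ctx : RootSystemCtx V) : V × ℚ × ℚ := (0, 1, 0)

/-- the affine simple root `α₀ = δ - θ` -/
def alpha0 : V × ℚ × ℚ := (-ctx.θ, 1, 0)

/-- the extension of the inner product to `V̂`, with
`(δ,V)=(λ,V)=(δ,δ)=(λ,λ)=0` and `(δ,λ)=1` -/
noncomputable def Bhat : (V × ℚ × ℚ) →ₗ[ℚ] (V × ℚ × ℚ) →ₗ[ℚ] ℚ :=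
  LinearMap.mk₂ ℚ (fun x y => ctx.B x.1 y.1 + x.2.1 * y.2.2 + x.2.2 * y.2.1)
    (fun x x' y => by
      simp only [Prod.fst_add, Prod.snd_add, map_add, LinearMap.add_apply]; ring)
    (fun c x y => by
      simp only [Prod.smul_fst, Prod.smul_snd, map_smul, LinearMap.smul_apply,
        smul_eq_mul]; ring)
    (fun x y y' => by
      simp only [Prod.fst_add, Prod.snd_add, map_add]; ring)
    (fun c x y => by
      simp only [Prod.smul_fst, Prod.smul_snd, map_smul, smul_eq_mul]; ring)

/-- the set `Δ̂` of affine real roots -/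
def Δhat : Set (V × ℚ × ℚ) := {x | ∃ α ∈ ctx.Δ, ∃ k : ℤ, x = (α, (k : ℚ), 0)}

/-- the set `Δ̂⁺` of positive affine roots -/
def PosHat : Set (V × ℚ × ℚ) :=
  {x | ∃ α ∈ ctx.Pos, x = (α, 0, 0)} ∪
    {x | ∃ α ∈ ctx.Δ, ∃ k : ℤ, 1 ≤ k ∧ x = (α, (k : ℚ), 0)}

/-- the set `Π̂ = Π ∪ {α₀}` of affine simple roots -/
def SimpleHat : Set (V × ℚ × ℚ) :=
  {x | ∃ α ∈ ctx.simple, x = (α, (0 : ℚ), (0 : ℚ))} ∪ {ctx.alpha0}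

/-- the reflection `s_β : x ↦ x − (2(x,β)/(β,β))·β` in `V̂` -/
noncomputable def refl (β : V × ℚ × ℚ) : (V × ℚ × ℚ) ≃ₗ[ℚ] (V × ℚ × ℚ) :=
  if h : ctx.Bhat β β = 0 then LinearEquiv.refl ℚ _
  else
    Module.reflection (x := β) (f := (2 / ctx.Bhat β β) • ctx.Bhat β)
      (by simp only [LinearMap.smul_apply, smul_eq_mul]; field_simp)

/-- the affine Weyl group `Ŵ`, generated by the reflections `s_β`, `β ∈ Δ̂` -/
def What : Subgroup ((V × ℚ × ℚ) ≃ₗ[ℚ] (V × ℚ × ℚ)) :=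
  Subgroup.closure {g | ∃ β ∈ ctx.Δhat, g = ctx.refl β}

/-- the finite Weyl group `W`, generated by the reflections `s_α`, `α ∈ Δ`
(identified with a subgroup of `Ŵ`) -/
def Wfin : Subgroup ((V × ℚ × ℚ) ≃ₗ[ℚ] (V × ℚ × ℚ)) :=
  Subgroup.closure {g | ∃ α ∈ ctx.Δ, g = ctx.refl (α, (0 : ℚ), (0 : ℚ))}

/-- `N̂(w) = {β ∈ Δ̂⁺ : w(β) ∈ −Δ̂⁺}` -/
def Nhat (w : (V × ℚ × ℚ) ≃ₗ[ℚ] (V × ℚ × ℚ)) : Set (V × ℚ × ℚ) :=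
  {β | β ∈ ctx.PosHat ∧ -(w β) ∈ ctx.PosHat}

/-- a minuscule element of `Ŵ`: every element of `N̂(w)` has the form `δ - γ`
with `γ ∈ Δ⁺` -/
def IsMinuscule (w : (V × ℚ × ℚ) ≃ₗ[ℚ] (V × ℚ × ℚ)) : Prop :=
  w ∈ ctx.What ∧ ∀ β ∈ ctx.Nhat w, ∃ γ ∈ ctx.Pos, β = ctx.δhat - ctx.emb γ

/-- the abelian ideal `I_w` corresponding to a minuscule element `w` -/
def idealOf (w : (V × ℚ × ℚ) ≃ₗ[ℚ] (V × ℚ × ℚ)) : Set V :=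
  {γ | γ ∈ ctx.Pos ∧ ctx.δhat - ctx.emb γ ∈ ctx.Nhat w}

/-- the ideal `I` has rootlet `τ(I) = μ`, i.e. `I = I_w` for some minuscule `w`
with `w(α₀) + δ = μ` -/
def HasRootlet (I : Set V) (μ : V) : Prop :=
  ∃ w, ctx.IsMinuscule w ∧ ctx.idealOf w = I ∧ w ctx.alpha0 + ctx.δhat = ctx.emb μ

/-- `Ab_μ`, the set of nonempty abelian ideals with rootlet `μ` -/
def AbFiber (μ : V) : Set (Set V) := {I | I.Nonempty ∧ ctx.HasRootlet I μ}

/-- `N(u) = {γ ∈ Δ⁺ : u(γ) ∈ −Δ⁺}` for `u` in the finite Weyl group -/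
def Nfin (w : (V × ℚ × ℚ) ≃ₗ[ℚ] (V × ℚ × ℚ)) : Set V :=
  {γ | γ ∈ ctx.Pos ∧ -(w (ctx.emb γ)) ∈ ctx.PosHat}

/-- the length `l(u) = #N(u)` of an element of the finite Weyl group -/
noncomputable def lenFin (w : (V × ℚ × ℚ) ≃ₗ[ℚ] (V × ℚ × ℚ)) : ℕ :=
  (ctx.Nfin w).ncard

end RootSystemCtx

namespace RootSystemCtx

variable {V : Type*} [AddCommGroup V] [Module ℚ V] (ctx : RootSystemCtx V)

/-! ### Finite root system -/

/-- the Cartan pairing `(x, α∨)` -/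
def pair (x α : V) : ℚ := 2 * ctx.B x α / ctx.B α α

variable {ctx}

theorem ne_zero_of_mem {α : V} (hα : α ∈ ctx.Δ) : α ≠ 0 := fun h => ctx.zero_notMem_Δ (h ▸ hα)

theorem B_self_pos {α : V} (hα : α ∈ ctx.Δ) : 0 < ctx.B α α := ctx.B_posdef α (ne_zero_of_mem hα)

theorem pair_eq_int {α β : V} (hα : α ∈ ctx.Δ) (hβ : β ∈ ctx.Δ) : ∃ n : ℤ, ctx.pair α β = n :=
  ctx.crystallographic α hα β hβ

theorem reflect_pair_mem {α γ : V} (hα : α ∈ ctx.Δ) (hγ : γ ∈ ctx.Δ) :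
    γ - ctx.pair γ α • α ∈ ctx.Δ :=
  ctx.reflect_mem α hα γ hγ

theorem pair_mul {α β : V} (hβ : β ∈ ctx.Δ) : ctx.pair α β * ctx.B β β = 2 * ctx.B α β := by
  have := (B_self_pos hβ).ne'
  unfold pair
  field_simp

theorem pair_pos_iff {α β : V} (hβ : β ∈ ctx.Δ) : 0 < ctx.pair α β ↔ 0 < ctx.B α β := by
  have h := B_self_pos hβ
  have e := pair_mul (α := α) hβ
  constructor
  · intro h1
    nlinarith [mul_pos h1 h]
  · intro h1
    by_contra! h2
    nlinarith [mul_nonneg (neg_nonneg.2 h2) h.le]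

theorem pair_neg (α β : V) : ctx.pair (-α) β = -ctx.pair α β := by
  simp [pair, neg_div]

theorem pair_self {α : V} (hα : α ∈ ctx.Δ) : ctx.pair α α = 2 := by
  have := (B_self_pos hα).ne'
  unfold pair
  field_simp

theorem mem_of_pos {α : V} (h : α ∈ ctx.Pos) : α ∈ ctx.Δ := ctx.pos_subset h

theorem neg_mem_pos_iff {α : V} (hα : α ∈ ctx.Δ) : -α ∈ ctx.Pos ↔ α ∉ ctx.Pos :=
  ⟨fun h h' => ctx.pos_not_neg α h' h, fun h => (ctx.mem_pos_or_neg_pos α hα).resolve_left h⟩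

theorem add_mem_of_neg {α β : V} (hα : α ∈ ctx.Δ) (hβ : β ∈ ctx.Δ) (h : ctx.B α β < 0)
    (h0 : α + β ≠ 0) : α + β ∈ ctx.Δ := by
  have hA := B_self_pos hα
  have hB := B_self_pos hβ
  obtain ⟨n, hn⟩ := pair_eq_int hα hβ
  obtain ⟨m, hm⟩ := pair_eq_int hβ hα
  have en := pair_mul (α := α) hβ
  have em := pair_mul (α := β) hα
  rw [hn] at en
  rw [hm, ctx.B_symm β α] at em
  have hn0 : n ≤ -1 := by
    by_contra! h1
    have : (0 : ℚ) ≤ n := by exact_mod_cast (by omega : 0 ≤ n)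
    nlinarith [mul_nonneg this hB.le]
  have hm0 : m ≤ -1 := by
    by_contra! h1
    have : (0 : ℚ) ≤ m := by exact_mod_cast (by omega : 0 ≤ m)
    nlinarith [mul_nonneg this hA.le]
  set x := ctx.B β β • α - ctx.B α β • β with hx
  by_cases hx0 : x = 0
  · have e : (ctx.B α β / ctx.B β β) • β = α := by
      rw [hx, sub_eq_zero] at hx0
      rw [div_eq_inv_mul, mul_smul, ← hx0, smul_smul, inv_mul_cancel₀ hB.ne', one_smul]
    rcases ctx.reduced β hβ (ctx.B α β / ctx.B β β) (e.symm ▸ hα) with h1 | h1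
    · rw [h1, one_smul] at e
      subst e
      linarith
    · rw [h1] at e
      exact absurd (by rw [← e]; simp) h0
  · have hpos := ctx.B_posdef x hx0
    have e : ctx.B x x = ctx.B β β * (ctx.B α α * ctx.B β β - ctx.B α β ^ 2) := by
      simp only [hx, map_sub, map_smul, LinearMap.sub_apply, LinearMap.smul_apply, smul_eq_mul,
        ctx.B_symm β α]
      ring
    rw [e] at hpos
    have hcs := pos_of_mul_pos_right hpos hB.le
    have hnm : n * m < 4 := by
      have : (n * m : ℚ) < 4 := by
        by_contra! h1
        have e2 : (n * m : ℚ) * (ctx.B α α * ctx.B β β) = 4 * ctx.B α β ^ 2 := by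
          linear_combination (m * ctx.B α α : ℚ) * en + 2 * ctx.B α β * em
        nlinarith [mul_le_mul_of_nonneg_right h1 (mul_pos hA hB).le]
      exact_mod_cast this
    have : n = -1 ∨ m = -1 := by
      by_contra! h1
      have h2 : n ≤ -2 := by omega
      have h3 : m ≤ -2 := by omega
      nlinarith
    rcases this with rfl | rfl
    · have := ctx.reflect_mem β hβ α hα
      change α - ctx.pair α β • β ∈ _ at this
      rw [hn] at this
      simpa using this
    · have := ctx.reflect_mem α hα β hβ
      change β - ctx.pair β α • α ∈ _ at this
      rw [hm] at this
      simpa [add_comm] using this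

theorem sub_mem_of_pos {α β : V} (hα : α ∈ ctx.Δ) (hβ : β ∈ ctx.Δ) (h : 0 < ctx.B α β)
    (h0 : α ≠ β) : α - β ∈ ctx.Δ := by
  rw [sub_eq_add_neg]
  apply add_mem_of_neg hα (ctx.neg_mem_Δ β hβ)
  · simpa using h
  · rwa [← sub_eq_add_neg, sub_ne_zero]

/-- A nonempty sum of positive roots does not vanish. -/
theorem multiset_sum_ne_zero (n : ℕ) : ∀ s : Multiset V, s.card = n + 1 →
    (∀ x ∈ s, x ∈ ctx.Pos) → s.sum ≠ 0 := by
  induction n with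
  | zero =>
    intro s hs hp h0
    obtain ⟨a, rfl⟩ := Multiset.card_eq_one.1 hs
    simp only [Multiset.sum_singleton] at h0
    exact ne_zero_of_mem (mem_of_pos (hp a (by simp))) h0
  | succ n ih =>
    intro s hs hp h0
    obtain ⟨a, has⟩ := Multiset.card_pos_iff_exists_mem.1 (by omega : 0 < s.card)
    obtain ⟨t, rfl⟩ := Multiset.exists_cons_of_mem has
    rw [Multiset.sum_cons] at h0
    have ha : a ∈ ctx.Pos := hp a (by simp)
    have hA := B_self_pos (mem_of_pos ha)
    have hex : ∃ b ∈ t, ctx.B a b < 0 := by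
      by_contra! h1
      have h2 : ctx.B a (a + t.sum) = 0 := by rw [h0, map_zero]
      rw [map_add, map_multiset_sum] at h2
      have : 0 ≤ (t.map (ctx.B a)).sum := Multiset.sum_nonneg (by simpa using h1)
      linarith
    obtain ⟨b, hb, hab⟩ := hex
    obtain ⟨r, rfl⟩ := Multiset.exists_cons_of_mem hb
    have hbp : b ∈ ctx.Pos := hp b (by simp)
    have hne : a + b ≠ 0 := fun h => by
      rw [eq_neg_of_add_eq_zero_right h] at hbp
      exact ctx.pos_not_neg a ha hbp
    have hadd := ctx.add_pos_mem a ha b hbp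
      (add_mem_of_neg (mem_of_pos ha) (mem_of_pos hbp) hab hne)
    refine ih ((a + b) ::ₘ r) (by simpa using hs) ?_ (by simpa [add_assoc] using h0)
    intro x hx
    rcases Multiset.mem_cons.1 hx with rfl | hx
    · exact hadd
    · exact hp x (by simp [hx])

/-- The cone spanned by the positive roots is pointed. -/
theorem eq_zero_of_mem_closure {x : V} (hx : x ∈ AddSubmonoid.closure ctx.Pos)
    (hx' : -x ∈ AddSubmonoid.closure ctx.Pos) : x = 0 := by
  obtain ⟨s, hs, rfl⟩ := AddSubmonoid.exists_multiset_of_mem_closure hx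
  obtain ⟨t, ht, hts⟩ := AddSubmonoid.exists_multiset_of_mem_closure hx'
  rcases Nat.eq_zero_or_pos s.card with h | h
  · simp [Multiset.card_eq_zero.1 h]
  · refine absurd ?_ (multiset_sum_ne_zero (ctx := ctx) (s.card + t.card - 1) (s + t)
      (by rw [Multiset.card_add]; omega) ?_)
    · rw [Multiset.sum_add, hts, add_neg_cancel]
    · intro x hx
      rcases Multiset.mem_add.1 hx with hx | hx
      exacts [hs x hx, ht x hx]

theorem mem_closure_of_pos {α : V} (h : α ∈ ctx.Pos) : α ∈ AddSubmonoid.closure ctx.Pos :=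
  AddSubmonoid.subset_closure h

theorem neg_notMem_closure {α : V} (h : α ∈ ctx.Pos) : -α ∉ AddSubmonoid.closure ctx.Pos :=
  fun h' => ne_zero_of_mem (mem_of_pos h) (eq_zero_of_mem_closure (mem_closure_of_pos h) h')

theorem pos_of_mem_closure {α : V} (hα : α ∈ ctx.Δ) (h : α ∈ AddSubmonoid.closure ctx.Pos) :
    α ∈ ctx.Pos := by
  by_contra h'
  have := (neg_mem_pos_iff hα).2 h'
  exact neg_notMem_closure this (by simpa using h)

theorem sub_simple_mem_pos {a γ : V} (ha : a ∈ ctx.simple) (hγ : γ ∈ ctx.Pos) (hne : γ ≠ a)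
    (h : 0 < ctx.B γ a) : γ - a ∈ ctx.Pos := by
  have h1 := sub_mem_of_pos (mem_of_pos hγ) (mem_of_pos ha.1) h hne
  rcases ctx.mem_pos_or_neg_pos _ h1 with h2 | h2
  · exact h2
  · exact absurd ⟨γ, hγ, _, h2, by abel⟩ ha.2

theorem add_ne_nsmul_simple {a : V} (ha : a ∈ ctx.simple) (c : ℕ) : ∀ γ ∈ ctx.Pos, ∀ η ∈ ctx.Pos,
    γ ≠ a → η ≠ a → γ + η ≠ c • a := by
  have two : ∀ γ ∈ ctx.Pos, γ - a ≠ a := fun γ hγ h => by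
    have e : γ = (2 : ℚ) • a := by
      rw [two_smul]; exact sub_eq_iff_eq_add.1 h
    rcases ctx.reduced a (mem_of_pos ha.1) 2 (e ▸ mem_of_pos hγ) with h | h <;> norm_num at h
  induction c with
  | zero =>
    intro γ hγ η hη _ _ h
    rw [zero_smul] at h
    rw [eq_neg_of_add_eq_zero_right h] at hη
    exact ctx.pos_not_neg γ hγ hη
  | succ c ih =>
    intro γ hγ η hη h1 h2 h
    have hA := B_self_pos (mem_of_pos ha.1)
    have hB : 0 < ctx.B γ a + ctx.B η a := by
      rw [← LinearMap.add_apply, ← map_add, h, map_nsmul, LinearMap.smul_apply]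
      positivity
    rw [succ_nsmul] at h
    by_cases h3 : 0 < ctx.B γ a
    · exact ih _ (sub_simple_mem_pos ha hγ h1 h3) η hη (two γ hγ) h2
        (by rw [sub_add_eq_add_sub, h, add_sub_cancel_right])
    · exact ih γ hγ _ (sub_simple_mem_pos ha hη h2 (by linarith)) h1 (two η hη)
        (by rw [← add_sub_assoc, h, add_sub_cancel_right])

/-- A simple reflection permutes the other positive roots. -/
theorem simple_reflect_pos {a γ : V} (ha : a ∈ ctx.simple) (hγ : γ ∈ ctx.Pos) (hne : γ ≠ a) :
    γ - ctx.pair γ a • a ∈ ctx.Pos := by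
  have haΔ := mem_of_pos ha.1
  have hΔ : γ - ctx.pair γ a • a ∈ ctx.Δ := ctx.reflect_mem a haΔ γ (mem_of_pos hγ)
  by_contra hn
  have hη := (neg_mem_pos_iff hΔ).2 hn
  obtain ⟨c, hc⟩ := pair_eq_int (mem_of_pos hγ) haΔ
  rw [hc, Int.cast_smul_eq_zsmul] at hη
  by_cases hc0 : 0 ≤ c
  · lift c to ℕ using hc0
    rw [natCast_zsmul] at hη
    refine add_ne_nsmul_simple ha c γ hγ _ hη hne ?_ (by abel)
    intro h
    have h2 : ctx.B (-(γ - (c : ℕ) • a)) a = ctx.B a a := by rw [h]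
    have h3 := pair_mul (α := γ) haΔ
    rw [hc] at h3
    simp only [neg_sub, map_sub, map_nsmul, LinearMap.sub_apply, LinearMap.smul_apply,
      nsmul_eq_mul] at h2
    push_cast at h3
    have hA := B_self_pos haΔ
    have h4 : (c : ℚ) = 2 := by
      have : ((c : ℚ) - 2) * ctx.B a a = 0 := by linarith
      rcases mul_eq_zero.1 this with h | h <;> linarith
    have h5 : c = 2 := by exact_mod_cast h4
    rw [h5, two_nsmul, neg_sub, sub_eq_iff_eq_add] at h
    exact hne (add_left_cancel h).symm
  · obtain ⟨d, rfl⟩ : ∃ d : ℕ, c = -d := ⟨c.natAbs, by omega⟩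
    refine neg_notMem_closure hγ ?_
    have : -γ = -(γ - (-(d : ℤ)) • a) + d • a := by
      rw [neg_smul, natCast_zsmul]; abel
    rw [this]
    exact add_mem (mem_closure_of_pos hη) (nsmul_mem (mem_closure_of_pos ha.1) d)

theorem pos_finite : ctx.Pos.Finite := ctx.Δ_finite.subset ctx.pos_subset

theorem pos_subset_closure_simple {α : V} (hα : α ∈ ctx.Pos) :
    α ∈ AddSubmonoid.closure ctx.simple := by
  let D : V → Set V := fun α => {ν | ν ∈ ctx.Pos ∧ α - ν ∈ AddSubmonoid.closure ctx.Pos}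
  have key : ∀ α β : V, β ∈ ctx.Pos → α + β ∈ ctx.Pos → (D α).ncard < (D (α + β)).ncard := by
    intro α β hβ hs
    refine Set.ncard_lt_ncard ⟨fun ν hν => ⟨hν.1, ?_⟩, fun h => ?_⟩
      (pos_finite.subset fun _ h => h.1)
    · rw [add_sub_right_comm]
      exact add_mem hν.2 (mem_closure_of_pos hβ)
    · have := (h (show α + β ∈ D (α + β) from ⟨hs, by simp⟩)).2
      rw [sub_add_cancel_left] at this
      exact neg_notMem_closure hβ this
  induction hn : (D α).ncard using Nat.strong_induction_on generalizing α with
  | _ n ih =>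
    by_cases hs : α ∈ ctx.simple
    · exact AddSubmonoid.subset_closure hs
    · obtain ⟨β, hβ, γ, hγ, rfl⟩ : ∃ β ∈ ctx.Pos, ∃ γ ∈ ctx.Pos, α = β + γ := by
        by_contra h
        exact hs ⟨hα, h⟩
      refine add_mem (ih _ ?_ hβ rfl) (ih _ ?_ hγ rfl)
      · exact hn ▸ key β γ hγ hα
      · rw [add_comm] at hα hn
        exact hn ▸ key γ β hβ hα

variable (ctx) in
/-- the height functional `x ↦ (x, 2ρ∨)`, twice the usual height -/
noncomputable def height : V →ₗ[ℚ] ℚ :=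
  ∑ γ ∈ (pos_finite (ctx := ctx)).toFinset, (2 / ctx.B γ γ) • ctx.B γ

theorem height_apply (x : V) :
    ctx.height x = ∑ γ ∈ (pos_finite (ctx := ctx)).toFinset, ctx.pair x γ := by
  simp only [height, LinearMap.sum_apply, LinearMap.smul_apply, smul_eq_mul, pair]
  refine Finset.sum_congr rfl fun γ _ => ?_
  rw [ctx.B_symm γ x]
  ring

theorem height_eq_int {α : V} (hα : α ∈ ctx.Δ) : ∃ n : ℤ, ctx.height α = n := by
  rw [height_apply]
  choose! f hf using fun γ (hγ : γ ∈ ctx.Δ) => pair_eq_int hα hγ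
  refine ⟨∑ γ ∈ (pos_finite (ctx := ctx)).toFinset, f γ, ?_⟩
  push_cast
  exact Finset.sum_congr rfl fun γ hγ => hf γ (mem_of_pos (pos_finite.mem_toFinset.1 hγ))

theorem B_reflect {a : V} (ha : a ∈ ctx.Δ) (x y : V) :
    ctx.B (x - ctx.pair x a • a) (y - ctx.pair y a • a) = ctx.B x y := by
  have hx := pair_mul (α := x) ha
  have hy := pair_mul (α := y) ha
  simp only [map_sub, map_smul, LinearMap.sub_apply, LinearMap.smul_apply, smul_eq_mul,
    ctx.B_symm a y]
  linear_combination ctx.pair x a / 2 * hy + ctx.pair y a / 2 * hx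

theorem reflect_reflect {a : V} (ha : a ∈ ctx.Δ) (x : V) :
    (x - ctx.pair x a • a) - ctx.pair (x - ctx.pair x a • a) a • a = x := by
  have : ctx.pair (x - ctx.pair x a • a) a = -ctx.pair x a := by
    have h := pair_self ha
    unfold pair at *
    simp only [map_sub, map_smul, LinearMap.sub_apply, LinearMap.smul_apply, smul_eq_mul]
    linear_combination (-(2 * ctx.B x a / ctx.B a a)) * h
  rw [this, neg_smul]
  abel

theorem height_simple {a : V} (ha : a ∈ ctx.simple) : ctx.height a = 2 := by
  classical
  have haΔ := mem_of_pos ha.1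
  have hmem : a ∈ (pos_finite (ctx := ctx)).toFinset := by simpa using ha.1
  rw [height_apply, ← Finset.add_sum_erase _ _ hmem, pair_self haΔ]
  set T := (pos_finite (ctx := ctx)).toFinset.erase a with hT
  have hmaps : ∀ γ ∈ T, γ - ctx.pair γ a • a ∈ T := by
    intro γ hγ
    simp only [hT, Finset.mem_erase, Set.Finite.mem_toFinset] at hγ ⊢
    refine ⟨fun h => ?_, simple_reflect_pos ha hγ.2 hγ.1⟩
    have h2 := reflect_reflect haΔ γ
    rw [h, pair_self haΔ, two_smul, sub_add_cancel_left] at h2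
    exact ctx.pos_not_neg a ha.1 (h2 ▸ hγ.2)
  have hsum : ∑ γ ∈ T, ctx.pair a γ = ∑ γ ∈ T, -ctx.pair a γ := by
    refine Finset.sum_bij' (fun γ _ => γ - ctx.pair γ a • a) (fun γ _ => γ - ctx.pair γ a • a)
      hmaps hmaps (fun γ _ => reflect_reflect haΔ γ) (fun γ _ => reflect_reflect haΔ γ) ?_
    intro γ _
    have h1 := B_reflect haΔ a γ
    rw [pair_self haΔ, two_smul, sub_add_cancel_left, map_neg, LinearMap.neg_apply] at h1
    simp only [pair] at h1 ⊢
    have h2 := B_reflect haΔ γ γ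
    simp only [pair] at h2
    rw [h2, ← h1]
    ring
  rw [Finset.sum_neg_distrib] at hsum
  linarith

theorem eq_zero_or_pos_of_mem_closure {f : V →ₗ[ℚ] ℚ} {S : Set V} (hf : ∀ a ∈ S, 0 < f a) {x : V}
    (hx : x ∈ AddSubmonoid.closure S) : x = 0 ∨ 0 < f x := by
  induction hx using AddSubmonoid.closure_induction with
  | mem a ha => exact Or.inr (hf a ha)
  | zero => exact Or.inl rfl
  | add x y _ _ hx hy =>
    rcases hx with rfl | hx
    · simpa using hy
    · rcases hy with rfl | hy
      · simpa using Or.inr hx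
      · right; rw [map_add]; exact add_pos hx hy

theorem height_pos {α : V} (hα : α ∈ ctx.Pos) : 0 < ctx.height α :=
  (eq_zero_or_pos_of_mem_closure (fun a ha => by rw [height_simple ha]; norm_num)
    (pos_subset_closure_simple hα)).resolve_left (ne_zero_of_mem (mem_of_pos hα))

theorem height_pos_iff {α : V} (hα : α ∈ ctx.Δ) : 0 < ctx.height α ↔ α ∈ ctx.Pos := by
  refine ⟨fun h => ?_, height_pos⟩
  by_contra h'
  have := height_pos ((neg_mem_pos_iff hα).2 h')
  rw [map_neg] at this
  linarith

theorem height_le {α : V} (hα : α ∈ ctx.Δ) : ctx.height α ≤ ctx.height ctx.θ := by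
  rcases eq_zero_or_pos_of_mem_closure (fun _ => height_pos) (ctx.θ_highest α hα) with h | h
  · rw [sub_eq_zero.1 h]
  · rw [map_sub] at h
    linarith

/-! ### The highest root -/

theorem θ_mem : ctx.θ ∈ ctx.Δ := mem_of_pos ctx.θ_pos

theorem eq_θ_of_height {α : V} (hα : α ∈ ctx.Δ) (h : ctx.height ctx.θ ≤ ctx.height α) :
    α = ctx.θ := by
  rcases eq_zero_or_pos_of_mem_closure (fun _ => height_pos) (ctx.θ_highest α hα) with h' | h'
  · exact (sub_eq_zero.1 h').symm
  · rw [map_sub] at h'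
    linarith

theorem θ_add_notMem {γ : V} (hγ : γ ∈ ctx.Pos) : ctx.θ + γ ∉ ctx.Δ := fun h => by
  have h1 := height_le h
  rw [map_add] at h1
  linarith [height_pos hγ]

theorem B_θ_nonneg {γ : V} (hγ : γ ∈ ctx.Pos) : 0 ≤ ctx.B γ ctx.θ := by
  by_contra! h
  have hne : ctx.θ + γ ≠ 0 := fun h' => by
    rw [eq_neg_of_add_eq_zero_right h'] at hγ
    exact ctx.pos_not_neg _ ctx.θ_pos hγ
  exact θ_add_notMem hγ (add_mem_of_neg θ_mem (mem_of_pos hγ) (by rwa [ctx.B_symm]) hne)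

theorem pair_θ_nonneg {γ : V} (hγ : γ ∈ ctx.Pos) : 0 ≤ ctx.pair γ ctx.θ := by
  by_contra! h
  have h1 := pair_mul (α := γ) (θ_mem (ctx := ctx))
  nlinarith [B_θ_nonneg hγ, mul_pos (neg_pos.2 h) (B_self_pos (θ_mem (ctx := ctx)))]

theorem reflect_θ_mem {γ : V} (hγ : γ ∈ ctx.Δ) : γ - ctx.pair γ ctx.θ • ctx.θ ∈ ctx.Δ :=
  ctx.reflect_mem ctx.θ θ_mem γ hγ

theorem eq_θ_of_pair {γ : V} (hγ : γ ∈ ctx.Δ) (h : 2 ≤ ctx.pair γ ctx.θ) : γ = ctx.θ := by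
  refine eq_θ_of_height hγ ?_
  have h1 := height_le (ctx.neg_mem_Δ _ (reflect_θ_mem hγ))
  have h2 := height_pos ctx.θ_pos
  rw [map_neg, map_sub, map_smul, smul_eq_mul] at h1
  nlinarith

theorem sub_θ_of_pos {γ : V} (hγ : γ ∈ ctx.Δ) (h : 0 < ctx.B γ ctx.θ) (hne : γ ≠ ctx.θ) :
    ctx.pair γ ctx.θ = 1 ∧ ctx.θ - γ ∈ ctx.Pos := by
  obtain ⟨n, hn⟩ := pair_eq_int hγ (θ_mem (ctx := ctx))
  have h1 := (pair_pos_iff θ_mem).2 h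
  have h2 : ¬ 2 ≤ ctx.pair γ ctx.θ := fun h => hne (eq_θ_of_pair hγ h)
  rw [hn] at h1 h2
  have h3 : n = 1 := by
    have : 0 < n := by exact_mod_cast h1
    have : ¬ 2 ≤ n := fun h => h2 (by exact_mod_cast h)
    omega
  rw [h3, Int.cast_one] at hn
  have h4 := ctx.neg_mem_Δ _ (reflect_θ_mem hγ)
  rw [hn, one_smul, neg_sub] at h4
  exact ⟨hn, pos_of_mem_closure h4 (ctx.θ_highest γ hγ)⟩

theorem pair_sub (x y α : V) : ctx.pair (x - y) α = ctx.pair x α - ctx.pair y α := by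
  simp only [pair, map_sub, LinearMap.sub_apply]
  ring

theorem pair_add (x y α : V) : ctx.pair (x + y) α = ctx.pair x α + ctx.pair y α := by
  simp only [pair, map_add, LinearMap.add_apply]
  ring

/-! ### The finite Weyl group acting on `V` -/

variable (ctx) in
/-- the reflection of `V` in a root -/
noncomputable def weylRefl (α : ctx.Δ) : V ≃ₗ[ℚ] V :=
  Module.reflection (x := (α : V)) (f := (2 / ctx.B α α) • ctx.B α) (by
    have := (B_self_pos α.2).ne'
    simp only [LinearMap.smul_apply, smul_eq_mul]
    field_simp)

theorem weylRefl_apply (α : ctx.Δ) (x : V) :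
    ctx.weylRefl α x = x - ctx.pair x α • (α : V) := by
  rw [weylRefl, Module.reflection_apply, LinearMap.smul_apply, smul_eq_mul, ctx.B_symm α x, pair]
  congr 2
  ring

variable (ctx) in
/-- the Weyl group acting on `V` -/
def weyl : Subgroup (V ≃ₗ[ℚ] V) := Subgroup.closure (Set.range ctx.weylRefl)

theorem weylRefl_mem (α : ctx.Δ) : ctx.weylRefl α ∈ ctx.weyl := Subgroup.subset_closure ⟨α, rfl⟩

theorem B_weyl {v : V ≃ₗ[ℚ] V} (hv : v ∈ ctx.weyl) (x y : V) :
    ctx.B (v x) (v y) = ctx.B x y := by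
  induction hv using Subgroup.closure_induction generalizing x y with
  | mem g hg =>
    obtain ⟨α, rfl⟩ := hg
    rw [weylRefl_apply, weylRefl_apply, B_reflect α.2]
  | one => rfl
  | mul g h _ _ hg hh => rw [LinearEquiv.mul_apply, LinearEquiv.mul_apply, hg, hh]
  | inv g _ hg =>
    rw [← hg (g⁻¹ x) (g⁻¹ y), ← LinearEquiv.mul_apply, ← LinearEquiv.mul_apply, mul_inv_cancel]
    rfl

theorem weyl_mem {v : V ≃ₗ[ℚ] V} (hv : v ∈ ctx.weyl) {α : V} (hα : α ∈ ctx.Δ) : v α ∈ ctx.Δ := by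
  induction hv using Subgroup.closure_induction_left generalizing α with
  | one => exact hα
  | mul_left g hg h _ hh =>
    obtain ⟨β, rfl⟩ := hg
    rw [LinearEquiv.mul_apply, weylRefl_apply]
    exact ctx.reflect_mem β β.2 _ (hh hα)
  | inv_mul_cancel g hg h _ hh =>
    obtain ⟨β, rfl⟩ := hg
    have : (ctx.weylRefl β)⁻¹ = ctx.weylRefl β := by
      rw [weylRefl]; exact Module.reflection_inv _
    rw [this, LinearEquiv.mul_apply, weylRefl_apply]
    exact ctx.reflect_mem β β.2 _ (hh hα)

/-- a simple root as a root -/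
def simpleRoot {a : V} (ha : a ∈ ctx.simple) : ctx.Δ := ⟨a, mem_of_pos ha.1⟩

theorem weylRefl_simple_pos {a γ : V} (ha : a ∈ ctx.simple) (hγ : γ ∈ ctx.Pos) (hne : γ ≠ a) :
    ctx.weylRefl (simpleRoot ha) γ ∈ ctx.Pos := by
  rw [weylRefl_apply]
  exact simple_reflect_pos ha hγ hne

theorem weylRefl_simple_self {a : V} (ha : a ∈ ctx.simple) :
    ctx.weylRefl (simpleRoot ha) a = -a := by
  rw [weylRefl_apply]
  simp only [simpleRoot]
  rw [pair_self (mem_of_pos ha.1), two_smul, sub_add_cancel_left]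

/-! ### Weyl group elements attached to ideals and to long roots -/

theorem θ_mem_of_ideal {I : Set V} (hne : I.Nonempty) (hI : ctx.IsAbelianIdeal I)
    (hH : I ⊆ {γ | γ ∈ ctx.Pos ∧ 0 < ctx.B γ ctx.θ}) : ctx.θ ∈ I := by
  obtain ⟨γ, hγ⟩ := hne
  by_cases h : γ = ctx.θ
  · exact h ▸ hγ
  · have := (sub_θ_of_pos (mem_of_pos (hH hγ).1) (hH hγ).2 h).2
    simpa using hI.2.2 γ hγ _ this (by simpa using θ_mem)

theorem exists_weyl_of_ideal (n : ℕ) : ∀ I : Set V, I.ncard = n → I.Nonempty →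
    ctx.IsAbelianIdeal I → I ⊆ {γ | γ ∈ ctx.Pos ∧ 0 < ctx.B γ ctx.θ} →
    ∃ v ∈ ctx.weyl, ∀ γ ∈ ctx.Pos, -(v γ) ∈ ctx.Pos ↔ ctx.θ - γ ∈ I := by
  induction n with
  | zero =>
    intro I hn hne hI _
    have := (Set.ncard_eq_zero (pos_finite.subset hI.1)).1 hn
    exact absurd this hne.ne_empty
  | succ n ih =>
    intro I hn hne hI hH
    have hθ := θ_mem_of_ideal hne hI hH
    have hfin := pos_finite.subset hI.1
    by_cases hsing : I = {ctx.θ}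
    · refine ⟨1, one_mem _, fun γ hγ => ⟨fun h => absurd h (ctx.pos_not_neg γ hγ), fun h => ?_⟩⟩
      rw [hsing, Set.mem_singleton_iff, sub_eq_self] at h
      exact absurd h (ne_zero_of_mem (mem_of_pos hγ))
    have hex : (I \ {ctx.θ}).Nonempty := by
      by_contra h
      rw [Set.not_nonempty_iff_eq_empty, Set.sdiff_eq_empty] at h
      exact hsing (h.antisymm (by simpa using hθ))
    obtain ⟨γ, ⟨hγI, hγθ⟩, hmin⟩ := Set.exists_min_image _ ctx.height (hfin.sdiff) hex
    rw [Set.mem_singleton_iff] at hγθ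
    have hγ := hI.1 hγI
    obtain ⟨hpγ, hδ⟩ := sub_θ_of_pos (mem_of_pos hγ) (hH hγI).2 hγθ
    have hI' : ctx.IsAbelianIdeal (I \ {γ}) := by
      refine ⟨fun x hx => hI.1 hx.1, fun x hx y hy => hI.2.1 x hx.1 y hy.1, ?_⟩
      refine fun x hx ν hν hs => ⟨hI.2.2 x hx.1 ν hν hs, fun h => ?_⟩
      rw [Set.mem_singleton_iff] at h
      by_cases hxθ : x = ctx.θ
      · exact θ_add_notMem hν (hxθ ▸ hs)
      · have h1 := hmin x ⟨hx.1, hxθ⟩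
        rw [← h, map_add] at h1
        linarith [height_pos hν]
    obtain ⟨v, hv, hvI⟩ := ih (I \ {γ})
      (by rw [Set.ncard_sdiff_singleton_of_mem hγI, hn]; rfl)
      ⟨ctx.θ, hθ, fun h => hγθ (Set.mem_singleton_iff.1 h).symm⟩ hI'
      (fun x hx => hH hx.1)
    have hαΔ : v (ctx.θ - γ) ∈ ctx.Δ := weyl_mem hv (mem_of_pos hδ)
    have hα : v (ctx.θ - γ) ∈ ctx.Pos := by
      by_contra h
      rw [← neg_mem_pos_iff hαΔ, hvI _ hδ, sub_sub_cancel] at h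
      exact h.2 rfl
    have hdec : ∀ x y : V, x ∈ ctx.Δ → y ∈ ctx.Δ → ctx.θ - γ = x + y → v x ∈ ctx.Pos →
        v y ∈ ctx.Pos → x ∈ ctx.Pos → False := by
      intro x y hx hy hxy hvx hvy hxp
      have hpair : ctx.pair x ctx.θ + ctx.pair y ctx.θ = 1 := by
        rw [← pair_add, ← hxy, pair_sub, pair_self θ_mem, hpγ]; norm_num
      have hout : ∀ z ∈ ctx.Pos, v z ∈ ctx.Pos → ctx.θ - z ∉ I \ {γ} := fun z hz hvz h =>
        ctx.pos_not_neg _ hvz ((hvI z hz).2 h)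
      have hmem : ∀ z t : V, z ∈ ctx.Pos → t ∈ ctx.Pos → ctx.θ - γ = z + t → v z ∈ ctx.Pos →
          0 < ctx.pair z ctx.θ → False := by
        intro z t hz ht hzt hvz hp
        have hzθ : z ≠ ctx.θ := by
          rintro rfl
          have : -γ = t := by
            rw [sub_eq_add_neg] at hzt
            exact add_left_cancel hzt
          exact ctx.pos_not_neg γ hγ (this ▸ ht)
        have h1 := (sub_θ_of_pos (mem_of_pos hz) ((pair_pos_iff θ_mem).1 hp) hzθ).2
        have e : ctx.θ - z = γ + t := by rw [sub_eq_iff_eq_add] at hzt ⊢; rw [hzt]; abel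
        refine hout z hz hvz ⟨?_, fun h => ?_⟩
        · rw [e]
          exact hI.2.2 γ hγI t ht (e ▸ mem_of_pos h1)
        · rw [e, Set.mem_singleton_iff, add_eq_left] at h
          exact ne_zero_of_mem (mem_of_pos ht) h
      by_cases hyp : y ∈ ctx.Pos
      · by_cases hpx : 0 < ctx.pair x ctx.θ
        · exact hmem x y hxp hyp hxy hvx hpx
        · exact hmem y x hyp hxp (by rw [hxy, add_comm]) hvy (by linarith)
      · have hny := (neg_mem_pos_iff hy).2 hyp
        have h1 : ctx.θ - -y ∈ I \ {γ} := (hvI _ hny).1 (by simpa using hvy)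
        have h2 := (pair_pos_iff θ_mem).2 (B_θ_nonneg hny |>.lt_of_ne' fun h0 => ?_)
        · have h3 : ¬ ctx.pair (-y) ctx.θ < 1 := by
            intro h3
            obtain ⟨m, hm⟩ := pair_eq_int (mem_of_pos hny) (θ_mem (ctx := ctx))
            rw [hm] at h2 h3
            have : 0 < m := by exact_mod_cast h2
            have : m < 1 := by exact_mod_cast h3
            omega
          rw [pair_neg] at h3
          have hxθ : x = ctx.θ := eq_θ_of_pair hx (by linarith)
          have hyγ : -y = γ := by
            rw [hxθ, sub_eq_add_neg] at hxy
            rw [← add_left_cancel hxy, neg_neg]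
          rw [hyγ] at h1
          exact hI.2.1 _ h1.1 _ hγI (by simpa using θ_mem)
        · have h3 := eq_θ_of_pair (mem_of_pos (hI.1 h1.1)) (by
            have : ctx.pair (-y) ctx.θ = 0 := by rw [pair, h0]; simp
            rw [pair_sub, pair_self θ_mem, this, sub_zero])
          rw [sub_eq_self] at h3
          exact ne_zero_of_mem (mem_of_pos hny) h3
    have hsimple : v (ctx.θ - γ) ∈ ctx.simple := by
      refine ⟨hα, ?_⟩
      rintro ⟨β₁, h₁, β₂, h₂, h⟩
      have hv' := inv_mem hv
      have hx := weyl_mem hv' (mem_of_pos h₁)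
      have hy := weyl_mem hv' (mem_of_pos h₂)
      have hvv : ∀ z, v (v⁻¹ z) = z := fun z => by
        rw [← LinearEquiv.mul_apply, mul_inv_cancel]; rfl
      have hsum : ctx.θ - γ = v⁻¹ β₁ + v⁻¹ β₂ := by
        rw [← map_add, ← h, ← LinearEquiv.mul_apply, inv_mul_cancel]; rfl
      by_cases hxp : v⁻¹ β₁ ∈ ctx.Pos
      · exact hdec _ _ hx hy hsum (by rwa [hvv]) (by rwa [hvv]) hxp
      by_cases hyp : v⁻¹ β₂ ∈ ctx.Pos
      · exact hdec _ _ hy hx (by rw [hsum, add_comm]) (by rwa [hvv]) (by rwa [hvv]) hyp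
      have h1 := height_pos ((neg_mem_pos_iff hx).2 hxp)
      have h2 := height_pos ((neg_mem_pos_iff hy).2 hyp)
      have h3 := height_pos hδ
      rw [hsum, map_add] at h3
      rw [map_neg] at h1 h2
      linarith
    refine ⟨ctx.weylRefl (simpleRoot hsimple) * v, mul_mem (weylRefl_mem _) hv, fun η hη => ?_⟩
    rw [LinearEquiv.mul_apply]
    by_cases hηγ : η = ctx.θ - γ
    · rw [hηγ, weylRefl_simple_self, neg_neg, sub_sub_cancel]
      exact iff_of_true hα hγI
    · have hvη : v η ∈ ctx.Δ := weyl_mem hv (mem_of_pos hη)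
      have hdiff : ctx.θ - η ∈ I \ {γ} ↔ ctx.θ - η ∈ I := by
        refine ⟨fun h => h.1, fun h => ⟨h, fun h' => hηγ ?_⟩⟩
        rw [Set.mem_singleton_iff] at h'
        rw [← h', sub_sub_cancel]
      rw [← hdiff, ← hvI η hη]
      have hne1 : v η ≠ v (ctx.θ - γ) := fun h => hηγ (v.injective h)
      have hne2 : -(v η) ≠ v (ctx.θ - γ) := fun h => by
        rw [← map_neg] at h
        exact ctx.pos_not_neg η hη (v.injective h ▸ hδ)
      by_cases hp : v η ∈ ctx.Pos
      · exact iff_of_false (ctx.pos_not_neg _ (weylRefl_simple_pos hsimple hp hne1))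
          (ctx.pos_not_neg _ hp)
      · have hn' := (neg_mem_pos_iff hvη).2 hp
        rw [← map_neg]
        exact iff_of_true (weylRefl_simple_pos hsimple hn' hne2) hn'

theorem nonneg_of_mem_closure {E : Type*} [AddCommGroup E] [Module ℚ E] {f : E →ₗ[ℚ] ℚ} {S : Set E}
    (hf : ∀ a ∈ S, 0 ≤ f a) {x : E} (hx : x ∈ AddSubmonoid.closure S) : 0 ≤ f x := by
  induction hx using AddSubmonoid.closure_induction with
  | mem a ha => exact hf a ha
  | zero => simp
  | add x y _ _ hx hy => rw [map_add]; exact add_nonneg hx hy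

theorem eq_θ_of_dominant {μ : V} (hμ : μ ∈ ctx.Δ) (hlong : ctx.B μ μ = ctx.B ctx.θ ctx.θ)
    (hdom : ∀ a ∈ ctx.simple, 0 ≤ ctx.B μ a) : μ = ctx.θ := by
  have hx := ctx.θ_highest μ hμ
  have h1 := nonneg_of_mem_closure (f := ctx.B μ)
    (fun γ hγ => nonneg_of_mem_closure hdom (pos_subset_closure_simple hγ)) hx
  have h2 := nonneg_of_mem_closure (f := ctx.B ctx.θ)
    (fun γ hγ => by rw [ctx.B_symm]; exact B_θ_nonneg hγ) hx
  by_contra hne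
  have h3 := ctx.B_posdef (ctx.θ - μ) (sub_ne_zero.2 fun h => hne h.symm)
  simp only [map_sub, LinearMap.sub_apply] at h1 h2 h3
  rw [ctx.B_symm ctx.θ μ] at h2 h3
  linarith

theorem exists_weyl_of_long (n : ℕ) : ∀ μ ∈ ctx.Δ, ctx.B μ μ = ctx.B ctx.θ ctx.θ →
    ctx.height ctx.θ - ctx.height μ ≤ n →
    ∃ v ∈ ctx.weyl, v ctx.θ = μ ∧ ∀ γ ∈ ctx.Pos, -(v γ) ∈ ctx.Pos → 0 < ctx.B γ ctx.θ := by
  have hθ : ∃ v ∈ ctx.weyl, v ctx.θ = ctx.θ ∧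
      ∀ γ ∈ ctx.Pos, -(v γ) ∈ ctx.Pos → 0 < ctx.B γ ctx.θ :=
    ⟨1, one_mem _, rfl, fun γ hγ h => absurd h (ctx.pos_not_neg γ hγ)⟩
  induction n with
  | zero =>
    intro μ hμ _ hle
    rw [eq_θ_of_height hμ (by simpa using hle)]
    exact hθ
  | succ n ih =>
    intro μ hμ hlong hle
    by_cases hdom : ∀ a ∈ ctx.simple, 0 ≤ ctx.B μ a
    · rw [eq_θ_of_dominant hμ hlong hdom]
      exact hθ
    push Not at hdom
    obtain ⟨a, ha, hneg⟩ := hdom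
    have haΔ := mem_of_pos ha.1
    set s := ctx.weylRefl (simpleRoot ha) with hs
    have hss : s (s μ) = μ := by
      rw [hs, weylRefl_apply, weylRefl_apply]
      exact reflect_reflect haΔ μ
    have hheight : ctx.height μ + 1 ≤ ctx.height (s μ) := by
      obtain ⟨m, hm⟩ := pair_eq_int hμ haΔ
      have h1 : m < 0 := by
        by_contra! h
        have h2 := pair_mul (α := μ) haΔ
        rw [hm] at h2
        have : (0 : ℚ) ≤ m := by exact_mod_cast h
        nlinarith [mul_nonneg this (B_self_pos haΔ).le]
      have h2 : (m : ℚ) ≤ -1 := by exact_mod_cast (by omega : m ≤ -1)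
      rw [hs, weylRefl_apply, map_sub, map_smul]
      simp only [simpleRoot]
      rw [height_simple ha, hm, smul_eq_mul]
      linarith
    obtain ⟨v, hv, hvθ, hvH⟩ := ih (s μ) (weyl_mem (weylRefl_mem _) hμ)
      (by rw [B_weyl (weylRefl_mem _), hlong]) (by push_cast at hle; linarith)
    refine ⟨s * v, mul_mem (weylRefl_mem _) hv, by rw [LinearEquiv.mul_apply, hvθ, hss], ?_⟩
    intro γ hγ hγn
    rw [LinearEquiv.mul_apply] at hγn
    have hvγ := weyl_mem hv (mem_of_pos hγ)
    by_cases hp : v γ ∈ ctx.Pos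
    · by_cases hva : v γ = a
      · rw [← B_weyl hv, hvθ, ← B_weyl (weylRefl_mem (simpleRoot ha)), ← hs, hss, hva, hs,
          weylRefl_simple_self, map_neg, LinearMap.neg_apply, ctx.B_symm]
        linarith
      · exact absurd hγn (ctx.pos_not_neg _ (weylRefl_simple_pos ha hp hva))
    · exact hvH γ hγ ((neg_mem_pos_iff hvγ).2 hp)

/-! ### Affine roots -/

theorem Bhat_apply (x y : V × ℚ × ℚ) :
    ctx.Bhat x y = ctx.B x.1 y.1 + x.2.1 * y.2.2 + x.2.2 * y.2.1 := rfl

theorem Bhat_symm (x y : V × ℚ × ℚ) : ctx.Bhat x y = ctx.Bhat y x := by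
  rw [Bhat_apply, Bhat_apply, ctx.B_symm]
  ring

theorem Bhat_mk (α β : V) (k l : ℚ) : ctx.Bhat (α, k, 0) (β, l, 0) = ctx.B α β := by
  simp [Bhat_apply]

theorem Bhat_self_pos {β : V × ℚ × ℚ} (hβ : β ∈ ctx.Δhat) : 0 < ctx.Bhat β β := by
  obtain ⟨α, hα, k, rfl⟩ := hβ
  rw [Bhat_mk]
  exact B_self_pos hα

theorem refl_apply {β : V × ℚ × ℚ} (hβ : β ∈ ctx.Δhat) (x : V × ℚ × ℚ) :
    ctx.refl β x = x - (2 * ctx.Bhat x β / ctx.Bhat β β) • β := by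
  have h := (Bhat_self_pos hβ).ne'
  rw [refl, dif_neg h, Module.reflection_apply, LinearMap.smul_apply, smul_eq_mul, Bhat_symm β x]
  congr 2
  ring

theorem refl_mk {α γ : V} (hα : α ∈ ctx.Δ) (l : ℤ) (k : ℚ) :
    ctx.refl (α, (l : ℚ), 0) (γ, k, 0) =
      (γ - ctx.pair γ α • α, k - ctx.pair γ α * l, 0) := by
  rw [refl_apply ⟨α, hα, l, rfl⟩, Bhat_mk, Bhat_mk]
  simp [pair]

theorem refl_refl {β : V × ℚ × ℚ} (hβ : β ∈ ctx.Δhat) : ctx.refl β * ctx.refl β = 1 := by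
  have h := (Bhat_self_pos hβ).ne'
  rw [refl, dif_neg h]
  ext1 x
  exact Module.involutive_reflection _ x

theorem refl_neg {β : V × ℚ × ℚ} (hβ : β ∈ ctx.Δhat) (hβ' : -β ∈ ctx.Δhat) :
    ctx.refl (-β) = ctx.refl β := by
  ext1 x
  rw [refl_apply hβ, refl_apply hβ']
  simp [neg_div]

theorem neg_mem_Δhat {β : V × ℚ × ℚ} (hβ : β ∈ ctx.Δhat) : -β ∈ ctx.Δhat := by
  obtain ⟨α, hα, k, rfl⟩ := hβ
  exact ⟨-α, ctx.neg_mem_Δ α hα, -k, by simp⟩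

theorem refl_mem_Δhat {β x : V × ℚ × ℚ} (hβ : β ∈ ctx.Δhat) (hx : x ∈ ctx.Δhat) :
    ctx.refl β x ∈ ctx.Δhat := by
  obtain ⟨α, hα, k, rfl⟩ := hβ
  obtain ⟨γ, hγ, l, rfl⟩ := hx
  obtain ⟨m, hm⟩ := pair_eq_int hγ hα
  rw [refl_mk hα]
  exact ⟨_, reflect_pair_mem hα hγ, l - m * k, by rw [hm]; push_cast; rfl⟩

theorem Bhat_refl {β : V × ℚ × ℚ} (hβ : β ∈ ctx.Δhat) (x y : V × ℚ × ℚ) :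
    ctx.Bhat (ctx.refl β x) (ctx.refl β y) = ctx.Bhat x y := by
  have h := (Bhat_self_pos hβ).ne'
  simp only [refl_apply hβ, map_sub, map_smul, LinearMap.sub_apply, LinearMap.smul_apply,
    smul_eq_mul, Bhat_symm β y]
  field_simp
  ring

theorem refl_mem_What {β : V × ℚ × ℚ} (hβ : β ∈ ctx.Δhat) : ctx.refl β ∈ ctx.What :=
  Subgroup.subset_closure ⟨β, hβ, rfl⟩

theorem What_mem_Δhat {w : (V × ℚ × ℚ) ≃ₗ[ℚ] (V × ℚ × ℚ)} (hw : w ∈ ctx.What)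
    {x : V × ℚ × ℚ} (hx : x ∈ ctx.Δhat) : w x ∈ ctx.Δhat := by
  induction hw using Subgroup.closure_induction_left generalizing x with
  | one => exact hx
  | mul_left g hg h _ hh =>
    obtain ⟨β, hβ, rfl⟩ := hg
    exact refl_mem_Δhat hβ (hh hx)
  | inv_mul_cancel g hg h _ hh =>
    obtain ⟨β, hβ, rfl⟩ := hg
    rw [inv_eq_of_mul_eq_one_right (refl_refl hβ)]
    exact refl_mem_Δhat hβ (hh hx)

theorem Bhat_What {w : (V × ℚ × ℚ) ≃ₗ[ℚ] (V × ℚ × ℚ)} (hw : w ∈ ctx.What) (x y : V × ℚ × ℚ) :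
    ctx.Bhat (w x) (w y) = ctx.Bhat x y := by
  induction hw using Subgroup.closure_induction generalizing x y with
  | mem g hg =>
    obtain ⟨β, hβ, rfl⟩ := hg
    exact Bhat_refl hβ x y
  | one => rfl
  | mul g h _ _ hg hh => rw [LinearEquiv.mul_apply, LinearEquiv.mul_apply, hg, hh]
  | inv g _ hg =>
    rw [← hg (g⁻¹ x) (g⁻¹ y), ← LinearEquiv.mul_apply, ← LinearEquiv.mul_apply, mul_inv_cancel]
    rfl

theorem mul_refl {w : (V × ℚ × ℚ) ≃ₗ[ℚ] (V × ℚ × ℚ)} (hw : w ∈ ctx.What) {β : V × ℚ × ℚ}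
    (hβ : β ∈ ctx.Δhat) : w * ctx.refl β = ctx.refl (w β) * w := by
  ext1 x
  rw [LinearEquiv.mul_apply, LinearEquiv.mul_apply, refl_apply hβ,
    refl_apply (What_mem_Δhat hw hβ), Bhat_What hw, Bhat_What hw, map_sub, map_smul]

variable (ctx) in
/-- a height functional on `V̂` which is positive exactly on the positive affine roots -/
noncomputable def heightHat : (V × ℚ × ℚ) →ₗ[ℚ] ℚ :=
  ctx.height ∘ₗ LinearMap.fst ℚ V (ℚ × ℚ) +
    (ctx.height ctx.θ + 1) • (LinearMap.fst ℚ ℚ ℚ ∘ₗ LinearMap.snd ℚ V (ℚ × ℚ))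

theorem heightHat_mk (α : V) (k l : ℚ) :
    ctx.heightHat (α, k, l) = ctx.height α + (ctx.height ctx.θ + 1) * k := rfl

theorem mk_mem_PosHat {α : V} {k : ℤ} :
    ((α, (k : ℚ), 0) : V × ℚ × ℚ) ∈ ctx.PosHat ↔ α ∈ ctx.Δ ∧ (0 < k ∨ k = 0 ∧ α ∈ ctx.Pos) := by
  constructor
  · rintro (⟨β, hβ, h⟩ | ⟨β, hβ, l, hl, h⟩)
    · simp only [Prod.mk.injEq, Int.cast_eq_zero, and_true] at h
      obtain ⟨rfl, rfl⟩ := h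
      exact ⟨mem_of_pos hβ, Or.inr ⟨rfl, hβ⟩⟩
    · simp only [Prod.mk.injEq, Int.cast_inj, and_true] at h
      obtain ⟨rfl, rfl⟩ := h
      exact ⟨hβ, Or.inl (by omega)⟩
  · rintro ⟨hα, hk | ⟨rfl, hp⟩⟩
    · exact Or.inr ⟨α, hα, k, by omega, rfl⟩
    · exact Or.inl ⟨α, hp, by simp⟩

theorem PosHat_subset : ctx.PosHat ⊆ ctx.Δhat := by
  rintro x (⟨β, hβ, rfl⟩ | ⟨β, hβ, l, hl, rfl⟩)
  · exact ⟨β, mem_of_pos hβ, 0, by simp⟩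
  · exact ⟨β, hβ, l, rfl⟩

theorem mem_PosHat_iff {x : V × ℚ × ℚ} (hx : x ∈ ctx.Δhat) :
    x ∈ ctx.PosHat ↔ 0 < ctx.heightHat x := by
  obtain ⟨α, hα, k, rfl⟩ := hx
  rw [mk_mem_PosHat, heightHat_mk, and_iff_right hα, ← height_pos_iff hα]
  have h1 := height_le hα
  have h2 := height_le (ctx.neg_mem_Δ α hα)
  rw [map_neg] at h2
  have h3 := height_pos ctx.θ_pos
  rcases lt_trichotomy k 0 with hk | rfl | hk
  · have : (k : ℚ) ≤ -1 := by exact_mod_cast (by omega : k ≤ -1)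
    refine iff_of_false (by omega) ?_
    nlinarith
  · simp
  · have : (1 : ℚ) ≤ k := by exact_mod_cast hk
    refine iff_of_true (Or.inl hk) ?_
    nlinarith

theorem neg_mem_PosHat_iff {x : V × ℚ × ℚ} (hx : x ∈ ctx.Δhat) :
    -x ∈ ctx.PosHat ↔ x ∉ ctx.PosHat := by
  have h0 : ctx.heightHat x ≠ 0 := by
    intro h
    obtain ⟨α, hα, k, rfl⟩ := hx
    have h1 := height_le hα
    have h2 := height_le (ctx.neg_mem_Δ α hα)
    rw [map_neg] at h2
    have h3 := height_pos ctx.θ_pos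
    rw [heightHat_mk] at h
    rcases lt_trichotomy k 0 with hk | rfl | hk
    · have : (k : ℚ) ≤ -1 := by exact_mod_cast (by omega : k ≤ -1)
      nlinarith
    · simp only [Int.cast_zero, mul_zero, add_zero] at h
      rcases ctx.mem_pos_or_neg_pos α hα with h4 | h4
      · linarith [height_pos h4]
      · have := height_pos h4
        rw [map_neg] at this
        linarith
    · have : (1 : ℚ) ≤ k := by exact_mod_cast hk
      nlinarith
  rw [mem_PosHat_iff hx, mem_PosHat_iff (neg_mem_Δhat hx), map_neg, neg_pos, not_lt]
  exact ⟨le_of_lt, fun h => lt_of_le_of_ne h h0⟩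

theorem heightHat_eq_int {x : V × ℚ × ℚ} (hx : x ∈ ctx.Δhat) : ∃ n : ℤ, ctx.heightHat x = n := by
  obtain ⟨α, hα, k, rfl⟩ := hx
  obtain ⟨n, hn⟩ := height_eq_int hα
  obtain ⟨m, hm⟩ := height_eq_int (θ_mem (ctx := ctx))
  exact ⟨n + (m + 1) * k, by rw [heightHat_mk, hn, hm]; push_cast; ring⟩

theorem alpha0_mem : ctx.alpha0 ∈ ctx.PosHat :=
  Or.inr ⟨-ctx.θ, ctx.neg_mem_Δ _ θ_mem, 1, le_rfl, by simp [alpha0]⟩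

theorem SimpleHat_subset : ctx.SimpleHat ⊆ ctx.PosHat := by
  rintro x (⟨α, hα, rfl⟩ | rfl)
  · exact Or.inl ⟨α, hα.1, rfl⟩
  · exact alpha0_mem

theorem refl_alpha0_mk {γ : V} {k : ℚ} :
    ctx.refl ctx.alpha0 (γ, k, 0) =
      (γ - ctx.pair γ ctx.θ • ctx.θ, k + ctx.pair γ ctx.θ, 0) := by
  have := refl_mk (γ := γ) (ctx.neg_mem_Δ _ (θ_mem (ctx := ctx))) 1 k
  have e : ctx.pair γ (-ctx.θ) = -ctx.pair γ ctx.θ := by simp [pair, neg_div]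
  rw [e] at this
  simpa [alpha0] using this

/-- A simple affine reflection permutes the other positive affine roots. -/
theorem refl_simple_pos {a β : V × ℚ × ℚ} (ha : a ∈ ctx.SimpleHat) (hβ : β ∈ ctx.PosHat)
    (hne : β ≠ a) : ctx.refl a β ∈ ctx.PosHat := by
  obtain ⟨γ, hγ, k, rfl⟩ := PosHat_subset hβ
  rw [mk_mem_PosHat, and_iff_right hγ] at hβ
  rcases ha with ⟨α, hα, rfl⟩ | rfl
  · have hαΔ := mem_of_pos hα.1
    have e := refl_mk (γ := γ) hαΔ 0 k
    simp only [Int.cast_zero, mul_zero, sub_zero] at e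
    rw [e, mk_mem_PosHat, and_iff_right (reflect_pair_mem hαΔ hγ)]
    refine hβ.imp_right fun ⟨hk, hp⟩ => ⟨hk, simple_reflect_pos hα hp fun h => hne ?_⟩
    rw [h, hk, Int.cast_zero]
  · obtain ⟨n, hn⟩ := pair_eq_int hγ (θ_mem (ctx := ctx))
    have hs := reflect_θ_mem hγ
    rw [refl_alpha0_mk]
    rw [hn] at hs ⊢
    rw [← Int.cast_add, mk_mem_PosHat, and_iff_right hs]
    by_cases hγθ : γ = -ctx.θ
    · have hn2 : n = -2 := by
        rw [hγθ, pair_neg, pair_self θ_mem] at hn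
        exact_mod_cast hn.symm
      subst hγθ hn2
      have hk1 : k ≠ 1 := by
        rintro rfl
        exact hne (by simp [alpha0])
      have hk0 : 0 < k := hβ.resolve_right fun h => ctx.pos_not_neg _ ctx.θ_pos h.2
      rcases (by omega : k = 2 ∨ 2 < k) with rfl | hk
      · refine Or.inr ⟨by norm_num, ?_⟩
        have : -ctx.θ - ((-2 : ℤ) : ℚ) • ctx.θ = ctx.θ := by
          push_cast; rw [neg_smul, two_smul]; abel
        rw [this]
        exact ctx.θ_pos
      · exact Or.inl (by omega)
    · have hn1 : -1 ≤ n := by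
        by_contra! h
        refine hγθ (neg_eq_iff_eq_neg.1 (eq_θ_of_pair (ctx.neg_mem_Δ _ hγ) ?_))
        rw [pair_neg, hn]
        exact_mod_cast (by omega : 2 ≤ -n)
      rcases hβ with hk | ⟨rfl, hp⟩
      · rcases (by omega : k + n = 0 ∨ 0 < k + n) with h | h
        · have : n = -1 := by omega
          subst this
          refine Or.inr ⟨h, (height_pos_iff hs).1 ?_⟩
          have h1 := height_le (ctx.neg_mem_Δ _ hγ)
          have h2 : ctx.height (-γ) ≠ ctx.height ctx.θ := fun h' =>
            hγθ (neg_eq_iff_eq_neg.1 (eq_θ_of_height (ctx.neg_mem_Δ _ hγ) h'.ge))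
          have h3 := lt_of_le_of_ne h1 h2
          rw [map_neg] at h3
          push_cast
          rw [map_sub, map_smul, smul_eq_mul]
          linarith
        · exact Or.inl h
      · have hn0 : 0 ≤ n := by
          have := pair_θ_nonneg hp
          rw [hn] at this
          exact_mod_cast this
        rcases hn0.eq_or_lt with rfl | h
        · exact Or.inr ⟨by norm_num, by simpa using hp⟩
        · exact Or.inl (by omega)

theorem refl_simple_self {a : V × ℚ × ℚ} (ha : a ∈ ctx.Δhat) : ctx.refl a a = -a := by
  have h := (Bhat_self_pos ha).ne'
  rw [refl_apply ha, mul_div_assoc, div_self h, mul_one, two_smul, sub_add_cancel_left]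

/-! ### The affine Weyl group acts freely on the alcoves -/

theorem heightHat_simple_pos {a : V × ℚ × ℚ} (ha : a ∈ ctx.SimpleHat) : 0 < ctx.heightHat a :=
  (mem_PosHat_iff (PosHat_subset (SimpleHat_subset ha))).1 (SimpleHat_subset ha)

theorem mk_mem_closure {x : V} (hx : x ∈ AddSubmonoid.closure ctx.Pos) :
    ((x, 0, 0) : V × ℚ × ℚ) ∈ AddSubmonoid.closure ctx.SimpleHat := by
  have hx' : x ∈ AddSubmonoid.closure ctx.simple :=
    (AddSubmonoid.closure_le.2 fun _ => pos_subset_closure_simple) hx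
  clear hx
  induction hx' using AddSubmonoid.closure_induction with
  | mem a ha => exact AddSubmonoid.subset_closure (Or.inl ⟨a, ha, rfl⟩)
  | zero => exact zero_mem _
  | add x y _ _ hx' hy' => simpa using add_mem hx' hy'

theorem PosHat_subset_closure {β : V × ℚ × ℚ} (hβ : β ∈ ctx.PosHat) :
    β ∈ AddSubmonoid.closure ctx.SimpleHat := by
  rcases hβ with ⟨α, hα, rfl⟩ | ⟨α, hα, k, hk, rfl⟩
  · exact mk_mem_closure (mem_closure_of_pos hα)
  · obtain ⟨n, rfl⟩ : ∃ n : ℕ, k = n + 1 := ⟨(k - 1).toNat, by omega⟩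
    have h1 : ctx.alpha0 ∈ AddSubmonoid.closure ctx.SimpleHat :=
      AddSubmonoid.subset_closure (Or.inr rfl)
    have h2 := mk_mem_closure (mem_closure_of_pos ctx.θ_pos)
    have h3 := mk_mem_closure (ctx.θ_highest _ (ctx.neg_mem_Δ α hα))
    have h4 := add_mem (add_mem (nsmul_mem h1 (n + 1)) (nsmul_mem h2 n)) h3
    convert h4 using 1
    ext
    · simp only [alpha0, Prod.fst_add, Prod.smul_fst, succ_nsmul, smul_neg]
      abel
    · simp [alpha0]
    · simp [alpha0]

theorem exists_simple_Bhat_pos {β : V × ℚ × ℚ} (hβ : β ∈ ctx.PosHat) :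
    ∃ a ∈ ctx.SimpleHat, 0 < ctx.Bhat β a := by
  by_contra! h
  have := nonneg_of_mem_closure (f := -ctx.Bhat β) (by simpa using h) (PosHat_subset_closure hβ)
  rw [LinearMap.neg_apply] at this
  linarith [Bhat_self_pos (PosHat_subset hβ)]

variable (ctx) in
/-- the subgroup generated by the simple affine reflections -/
def simpleGroup : Subgroup ((V × ℚ × ℚ) ≃ₗ[ℚ] (V × ℚ × ℚ)) :=
  Subgroup.closure (ctx.refl '' ctx.SimpleHat)

theorem refl_mem_simpleGroup (n : ℕ) : ∀ β ∈ ctx.PosHat, ctx.heightHat β ≤ n →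
    ctx.refl β ∈ ctx.simpleGroup := by
  induction n with
  | zero =>
    intro β hβ h
    have := (mem_PosHat_iff (PosHat_subset hβ)).1 hβ
    push_cast at h
    linarith
  | succ n ih =>
    intro β hβ hle
    by_cases hs : β ∈ ctx.SimpleHat
    · exact Subgroup.subset_closure ⟨β, hs, rfl⟩
    obtain ⟨a, ha, hpos⟩ := exists_simple_Bhat_pos hβ
    have haΔ := PosHat_subset (SimpleHat_subset ha)
    have hβΔ := PosHat_subset hβ
    have hmem := refl_simple_pos ha hβ (fun h => hs (h ▸ ha))
    have hlt : ctx.heightHat (ctx.refl a β) < ctx.heightHat β := by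
      rw [refl_apply haΔ, map_sub, map_smul, smul_eq_mul, sub_lt_self_iff]
      have := Bhat_self_pos haΔ
      have := heightHat_simple_pos ha
      positivity
    have hle' : ctx.heightHat (ctx.refl a β) ≤ n := by
      obtain ⟨m, hm⟩ := heightHat_eq_int (PosHat_subset hmem)
      obtain ⟨l, hl⟩ := heightHat_eq_int hβΔ
      rw [hm, hl] at hlt
      rw [hl] at hle
      rw [hm]
      have h1 : m < l := by exact_mod_cast hlt
      have h2 : l ≤ n + 1 := by exact_mod_cast hle
      exact_mod_cast (by omega : m ≤ n)
    have hg : ctx.refl a ∈ ctx.simpleGroup := Subgroup.subset_closure ⟨a, ha, rfl⟩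
    have e : ctx.refl β = ctx.refl a * ctx.refl (ctx.refl a β) * ctx.refl a := by
      rw [mul_assoc, ← mul_refl (refl_mem_What haΔ) hβΔ, ← mul_assoc, refl_refl haΔ, one_mul]
    rw [e]
    exact mul_mem (mul_mem hg (ih _ hmem hle')) hg

theorem What_le_simpleGroup : ctx.What ≤ ctx.simpleGroup := by
  rw [What, Subgroup.closure_le]
  have key : ∀ β ∈ ctx.PosHat, ctx.refl β ∈ ctx.simpleGroup := fun β hβ =>
    refl_mem_simpleGroup _ β hβ (Nat.le_ceil _)
  rintro _ ⟨β, hβ, rfl⟩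
  by_cases h : β ∈ ctx.PosHat
  · exact key β h
  · rw [← refl_neg hβ (neg_mem_Δhat hβ)]
    exact key _ ((neg_mem_PosHat_iff hβ).2 h)

theorem exists_word {u : (V × ℚ × ℚ) ≃ₗ[ℚ] (V × ℚ × ℚ)} (hu : u ∈ ctx.What) :
    ∃ L : List (V × ℚ × ℚ), (∀ a ∈ L, a ∈ ctx.SimpleHat) ∧ (L.map ctx.refl).prod = u := by
  have hu' : u ∈ Subgroup.closure (ctx.refl '' ctx.SimpleHat) := What_le_simpleGroup hu
  clear hu
  induction hu' using Subgroup.closure_induction_left with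
  | one => exact ⟨[], by simp, rfl⟩
  | mul_left g hg h _ hh =>
    obtain ⟨a, ha, rfl⟩ := hg
    obtain ⟨L, hL, rfl⟩ := hh
    exact ⟨a :: L, by simpa [ha] using hL, by simp⟩
  | inv_mul_cancel g hg h _ hh =>
    obtain ⟨a, ha, rfl⟩ := hg
    obtain ⟨L, hL, rfl⟩ := hh
    rw [inv_eq_of_mul_eq_one_right (refl_refl (PosHat_subset (SimpleHat_subset ha)))]
    exact ⟨a :: L, by simpa [ha] using hL, by simp⟩

theorem word_mem_What {L : List (V × ℚ × ℚ)} (hL : ∀ a ∈ L, a ∈ ctx.SimpleHat) :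
    (L.map ctx.refl).prod ∈ ctx.What := by
  refine Subgroup.list_prod_mem _ fun g hg => ?_
  obtain ⟨a, ha, rfl⟩ := List.mem_map.1 hg
  exact refl_mem_What (PosHat_subset (SimpleHat_subset (hL a ha)))

/-- The exchange condition. -/
theorem exchange {b : V × ℚ × ℚ} (hb : b ∈ ctx.SimpleHat) (L : List (V × ℚ × ℚ))
    (hL : ∀ a ∈ L, a ∈ ctx.SimpleHat) (h : (L.map ctx.refl).prod b ∉ ctx.PosHat) :
    ∃ L' : List (V × ℚ × ℚ), L'.length + 1 = L.length ∧ (∀ a ∈ L', a ∈ ctx.SimpleHat) ∧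
      (L'.map ctx.refl).prod = (L.map ctx.refl).prod * ctx.refl b := by
  have hbΔ := PosHat_subset (SimpleHat_subset hb)
  induction L with
  | nil => exact absurd (SimpleHat_subset hb) h
  | cons a L ih =>
    have hL' : ∀ a ∈ L, a ∈ ctx.SimpleHat := fun c hc => hL c (List.mem_cons_of_mem _ hc)
    have ha : a ∈ ctx.SimpleHat := hL a List.mem_cons_self
    have haΔ := PosHat_subset (SimpleHat_subset ha)
    rw [List.map_cons, List.prod_cons] at h ⊢
    by_cases h1 : (L.map ctx.refl).prod b ∈ ctx.PosHat
    · have h2 : (L.map ctx.refl).prod b = a := by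
        by_contra hne
        exact h (refl_simple_pos ha h1 hne)
      refine ⟨L, rfl, hL', ?_⟩
      rw [mul_assoc, mul_refl (word_mem_What hL') hbΔ, h2, ← mul_assoc, refl_refl haΔ, one_mul]
    · obtain ⟨L', hlen, hL'', hprod⟩ := ih hL' h1
      refine ⟨a :: L', by simp [← hlen], by simpa [ha] using hL'', ?_⟩
      rw [List.map_cons, List.prod_cons, hprod, mul_assoc]

/-- An element of the affine Weyl group preserving positivity is trivial. -/
theorem eq_one_of_PosHat {u : (V × ℚ × ℚ) ≃ₗ[ℚ] (V × ℚ × ℚ)} (hu : u ∈ ctx.What)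
    (hpos : ∀ β ∈ ctx.PosHat, u β ∈ ctx.PosHat) : u = 1 := by
  obtain ⟨L, hL, rfl⟩ := exists_word hu
  clear hu
  induction hn : L.length using Nat.strong_induction_on generalizing L with
  | _ n ih =>
    rcases List.eq_nil_or_concat L with rfl | ⟨L₀, b, rfl⟩
    · rfl
    rw [List.concat_eq_append] at *
    have hb : b ∈ ctx.SimpleHat := hL b (by simp)
    have hbΔ := PosHat_subset (SimpleHat_subset hb)
    have hL₀ : ∀ a ∈ L₀, a ∈ ctx.SimpleHat := fun a ha => hL a (by simp [ha])
    have e : ((L₀ ++ [b]).map ctx.refl).prod = (L₀.map ctx.refl).prod * ctx.refl b := by simp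
    have h1 : (L₀.map ctx.refl).prod b ∉ ctx.PosHat := by
      have h2 := hpos b (SimpleHat_subset hb)
      rw [e, LinearEquiv.mul_apply, refl_simple_self hbΔ, map_neg] at h2
      exact (neg_mem_PosHat_iff (What_mem_Δhat (word_mem_What hL₀) hbΔ)).1 h2
    obtain ⟨L', hlen, hL', hprod⟩ := exchange hb L₀ hL₀ h1
    rw [e, ← hprod] at hpos ⊢
    refine ih L'.length ?_ L' hL' hpos rfl
    rw [← hn, List.length_append]
    simp only [List.length_singleton]
    omega

/-! ### Minuscule elements -/

theorem minuscule_eq {w₁ w₂ : (V × ℚ × ℚ) ≃ₗ[ℚ] (V × ℚ × ℚ)} (h₁ : ctx.IsMinuscule w₁)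
    (h₂ : ctx.IsMinuscule w₂) (h : ctx.idealOf w₁ = ctx.idealOf w₂) : w₁ = w₂ := by
  have hsub : ∀ w w', ctx.IsMinuscule w → ctx.idealOf w = ctx.idealOf w' →
      ctx.Nhat w ⊆ ctx.Nhat w' := by
    intro w w' hw he β hβ
    obtain ⟨γ, hγ, rfl⟩ := hw.2 β hβ
    have : γ ∈ ctx.idealOf w' := he ▸ ⟨hγ, hβ⟩
    exact this.2
  have hN : ∀ β, β ∈ ctx.Nhat w₁ ↔ β ∈ ctx.Nhat w₂ := fun β =>
    ⟨fun hβ => hsub _ _ h₁ h hβ, fun hβ => hsub _ _ h₂ h.symm hβ⟩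
  have hpos : ∀ x ∈ ctx.PosHat, w₁ x ∈ ctx.PosHat ↔ w₂ x ∈ ctx.PosHat := by
    intro x hx
    have := hN x
    simp only [Nhat, Set.mem_ofPred_eq, hx, true_and,
      neg_mem_PosHat_iff (What_mem_Δhat h₁.1 (PosHat_subset hx)),
      neg_mem_PosHat_iff (What_mem_Δhat h₂.1 (PosHat_subset hx))] at this
    exact not_iff_not.1 this
  have hinv : w₂⁻¹ ∈ ctx.What := inv_mem h₂.1
  refine mul_inv_eq_one.1 (eq_one_of_PosHat (mul_mem h₁.1 hinv) fun β hβ => ?_)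
  rw [LinearEquiv.mul_apply]
  have hx := What_mem_Δhat hinv (PosHat_subset hβ)
  have hw : w₂ (w₂⁻¹ β) = β := by
    rw [← LinearEquiv.mul_apply, mul_inv_cancel]; rfl
  by_cases hp : w₂⁻¹ β ∈ ctx.PosHat
  · rw [hpos _ hp, hw]
    exact hβ
  · have hn := (neg_mem_PosHat_iff hx).2 hp
    have h3 := hpos _ hn
    rw [map_neg, map_neg, hw, neg_mem_PosHat_iff (PosHat_subset hβ),
      neg_mem_PosHat_iff (What_mem_Δhat h₁.1 hx)] at h3
    exact (not_iff_not.1 h3).2 hβ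

theorem isAbelianIdeal_idealOf {w : (V × ℚ × ℚ) ≃ₗ[ℚ] (V × ℚ × ℚ)} (hw : ctx.IsMinuscule w) :
    ctx.IsAbelianIdeal (ctx.idealOf w) := by
  have hroot : ∀ γ ∈ ctx.Δ, ∀ k : ℤ, ((γ, (k : ℚ), 0) : V × ℚ × ℚ) ∈ ctx.Δhat := fun γ hγ k =>
    ⟨γ, hγ, k, rfl⟩
  have hneg : ∀ x ∈ ctx.Δhat, -(w x) ∈ ctx.PosHat ↔ ctx.heightHat (w x) < 0 := fun x hx => by
    rw [mem_PosHat_iff (neg_mem_Δhat (What_mem_Δhat hw.1 hx)), map_neg, neg_pos]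
  have hδ : ∀ γ : V, ctx.δhat - ctx.emb γ = (-γ, ((1 : ℤ) : ℚ), 0) := fun γ => by
    simp [δhat, emb]
  refine ⟨fun γ hγ => hγ.1, fun μ hμ ν hν hsum => ?_, fun γ hγ ν hν hsum => ?_⟩
  · have h1 := hμ.2.2
    have h2 := hν.2.2
    rw [hδ, hneg _ (hroot _ (ctx.neg_mem_Δ _ (mem_of_pos hμ.1)) 1)] at h1
    rw [hδ, hneg _ (hroot _ (ctx.neg_mem_Δ _ (mem_of_pos hν.1)) 1)] at h2
    have hr := ctx.neg_mem_Δ _ hsum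
    have h3 : ((-(μ + ν), ((2 : ℤ) : ℚ), 0) : V × ℚ × ℚ) ∈ ctx.Nhat w := by
      refine ⟨mk_mem_PosHat.2 ⟨hr, Or.inl (by norm_num)⟩, (hneg _ (hroot _ hr 2)).2 ?_⟩
      have e : ((-(μ + ν), ((2 : ℤ) : ℚ), 0) : V × ℚ × ℚ) =
          (-μ, ((1 : ℤ) : ℚ), 0) + (-ν, ((1 : ℤ) : ℚ), 0) := by
        ext <;> simp <;> first | abel1 | norm_num
      rw [e, map_add, map_add]
      linarith
    obtain ⟨γ, _, hγ⟩ := hw.2 _ h3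
    rw [hδ] at hγ
    simp at hγ
  · have h1 := hγ.2.2
    rw [hδ, hneg _ (hroot _ (ctx.neg_mem_Δ _ (mem_of_pos hγ.1)) 1)] at h1
    have hr := ctx.neg_mem_Δ _ hsum
    have hνΔ := hroot _ (mem_of_pos hν) 0
    have h2 : 0 < ctx.heightHat (w (ν, ((0 : ℤ) : ℚ), 0)) := by
      rw [← mem_PosHat_iff (What_mem_Δhat hw.1 hνΔ)]
      by_contra h
      rw [← neg_mem_PosHat_iff (What_mem_Δhat hw.1 hνΔ)] at h
      obtain ⟨γ', _, hγ'⟩ := hw.2 _ ⟨mk_mem_PosHat.2 ⟨mem_of_pos hν, Or.inr ⟨rfl, hν⟩⟩, h⟩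
      rw [hδ] at hγ'
      simp at hγ'
    refine ⟨ctx.add_pos_mem _ hγ.1 _ hν hsum, ?_, ?_⟩
    · rw [hδ]
      exact mk_mem_PosHat.2 ⟨hr, Or.inl (by norm_num)⟩
    · rw [hδ, hneg _ (hroot _ hr 1)]
      have e : ((-γ, ((1 : ℤ) : ℚ), 0) : V × ℚ × ℚ) =
          (-(γ + ν), ((1 : ℤ) : ℚ), 0) + (ν, ((0 : ℤ) : ℚ), 0) := by
        ext <;> simp
      rw [e, map_add, map_add] at h1
      linarith

/-! ### Lifting the finite Weyl group -/

/-- the action of a linear automorphism of `V` on `V̂`, trivial on `δ` and `λ` -/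
def lift : (V ≃ₗ[ℚ] V) →* ((V × ℚ × ℚ) ≃ₗ[ℚ] (V × ℚ × ℚ)) where
  toFun u := u.prodCongr (LinearEquiv.refl ℚ (ℚ × ℚ))
  map_one' := rfl
  map_mul' _ _ := rfl

theorem lift_mk (u : V ≃ₗ[ℚ] V) (x : V) (k : ℚ × ℚ) : lift u (x, k) = (u x, k) := rfl

theorem lift_weylRefl (α : ctx.Δ) : lift (ctx.weylRefl α) = ctx.refl ((α : V), 0, 0) := by
  ext1 ⟨x, k, l⟩
  rw [lift_mk, weylRefl_apply, refl_apply ⟨(α : V), α.2, 0, by simp⟩]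
  simp [Bhat_apply, pair]

theorem lift_mem_What {v : V ≃ₗ[ℚ] V} (hv : v ∈ ctx.weyl) : lift v ∈ ctx.What := by
  have h : ctx.weyl ≤ ctx.What.comap lift := by
    rw [weyl, Subgroup.closure_le]
    rintro _ ⟨α, rfl⟩
    rw [SetLike.mem_coe, Subgroup.mem_comap, lift_weylRefl]
    exact refl_mem_What ⟨α, α.2, 0, by simp⟩
  exact h hv

variable (ctx) in
/-- elements `v` of the Weyl group for which `v s_θ` comes from a nonempty abelian ideal in the
set of roots `γ` with `(γ, θ) > 0` -/
def Adapted (v : V ≃ₗ[ℚ] V) : Prop :=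
  v ∈ ctx.weyl ∧ v ctx.θ ∈ ctx.Pos ∧ ∀ γ ∈ ctx.Pos, -(v γ) ∈ ctx.Pos → 0 < ctx.B γ ctx.θ

variable (ctx) in
/-- the affine Weyl group element `v s_{α₀}` -/
noncomputable def affineLift (v : V ≃ₗ[ℚ] V) : (V × ℚ × ℚ) ≃ₗ[ℚ] (V × ℚ × ℚ) :=
  lift v * ctx.refl ctx.alpha0

theorem affineLift_mk (v : V ≃ₗ[ℚ] V) (γ : V) (k : ℚ) :
    ctx.affineLift v (γ, k, 0) =
      (v (γ - ctx.pair γ ctx.θ • ctx.θ), k + ctx.pair γ ctx.θ, 0) := by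
  rw [affineLift, LinearEquiv.mul_apply, refl_alpha0_mk, lift_mk]

theorem neg_affineLift_mem {v : V ≃ₗ[ℚ] V} (hv : v ∈ ctx.weyl) {γ : V} (hγ : γ ∈ ctx.Δ) {n k : ℤ}
    (hn : ctx.pair γ ctx.θ = n) :
    -(ctx.affineLift v (γ, (k : ℚ), 0)) ∈ ctx.PosHat ↔
      k + n < 0 ∨ k + n = 0 ∧ -(v (γ - (n : ℚ) • ctx.θ)) ∈ ctx.Pos := by
  have e : -(ctx.affineLift v (γ, (k : ℚ), 0)) =
      (-(v (γ - (n : ℚ) • ctx.θ)), ((-(k + n) : ℤ) : ℚ), 0) := by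
    rw [affineLift_mk, hn]
    ext <;> simp [add_comm]
  have hmem := ctx.neg_mem_Δ _ (weyl_mem hv (hn ▸ reflect_θ_mem hγ))
  rw [e, mk_mem_PosHat, and_iff_right hmem, neg_pos, neg_eq_zero]

theorem affineLift_alpha0 (v : V ≃ₗ[ℚ] V) :
    ctx.affineLift v ctx.alpha0 + ctx.δhat = ctx.emb (v ctx.θ) := by
  rw [alpha0, affineLift_mk, pair_neg, pair_self θ_mem, δhat, emb]
  ext
  · simp [two_smul]
  · norm_num
  · simp

theorem eq_neg_θ_of_pair {γ : V} (hγ : γ ∈ ctx.Δ) (h : ctx.pair γ ctx.θ ≤ -2) : γ = -ctx.θ := by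
  rw [← eq_θ_of_pair (ctx.neg_mem_Δ γ hγ) (by rw [pair_neg]; linarith), neg_neg]

theorem isMinuscule_affineLift {v : V ≃ₗ[ℚ] V} (hv : ctx.Adapted v) :
    ctx.IsMinuscule (ctx.affineLift v) := by
  refine ⟨mul_mem (lift_mem_What hv.1) (refl_mem_What (PosHat_subset alpha0_mem)), ?_⟩
  rintro β ⟨hβ, hneg⟩
  obtain ⟨γ, hγ, k, rfl⟩ := PosHat_subset hβ
  obtain ⟨n, hn⟩ := pair_eq_int hγ (θ_mem (ctx := ctx))
  rw [neg_affineLift_mem hv.1 hγ hn] at hneg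
  have hβ' := (mk_mem_PosHat.1 hβ).2
  have hn0 : n < 0 := by
    by_contra! h
    obtain ⟨rfl, rfl⟩ : k = 0 ∧ n = 0 := by omega
    have h1 := hv.2.2 γ (by simpa using hβ') (by simpa using hneg)
    rw [← pair_pos_iff θ_mem, hn] at h1
    simp at h1
  have hγn : γ ∉ ctx.Pos := fun h => by
    have := pair_θ_nonneg h
    rw [hn] at this
    have : 0 ≤ n := by exact_mod_cast this
    omega
  have hk : k = 1 := by
    by_contra hk
    have hk2 : 2 ≤ k := by
      rcases hβ' with h | h
      · omega
      · exact absurd h.2 hγn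
    have hn2 : n ≤ -2 := by omega
    have hγ' := eq_neg_θ_of_pair hγ (by rw [hn]; exact_mod_cast hn2)
    have hn3 : n = -2 := by
      rw [hγ', pair_neg, pair_self θ_mem] at hn
      exact_mod_cast hn.symm
    subst hn3 hγ'
    rcases hneg with h | h
    · omega
    · refine ctx.pos_not_neg _ hv.2.1 ?_
      convert h.2 using 3
      push_cast
      module
  subst hk
  exact ⟨-γ, (neg_mem_pos_iff hγ).2 hγn, by simp [δhat, emb]⟩

theorem mem_idealOf_affineLift {v : V ≃ₗ[ℚ] V} (hv : ctx.Adapted v) {γ : V} :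
    γ ∈ ctx.idealOf (ctx.affineLift v) ↔
      γ = ctx.θ ∨ γ ∈ ctx.Pos ∧ ctx.θ - γ ∈ ctx.Pos ∧ -(v (ctx.θ - γ)) ∈ ctx.Pos := by
  have key : ∀ γ ∈ ctx.Pos, ∀ n : ℤ, ctx.pair γ ctx.θ = n →
      (γ ∈ ctx.idealOf (ctx.affineLift v) ↔
        1 < n ∨ n = 1 ∧ -(v (ctx.θ - γ)) ∈ ctx.Pos) := by
    intro γ hγ n hn
    have hγ' := ctx.neg_mem_Δ _ (mem_of_pos hγ)
    have e : ctx.δhat - ctx.emb γ = (-γ, ((1 : ℤ) : ℚ), 0) := by simp [δhat, emb]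
    have hn' : ctx.pair (-γ) ctx.θ = ((-n : ℤ) : ℚ) := by rw [pair_neg, hn]; push_cast; rfl
    have h1 : ((-γ, ((1 : ℤ) : ℚ), 0) : V × ℚ × ℚ) ∈ ctx.PosHat :=
      mk_mem_PosHat.2 ⟨hγ', Or.inl one_pos⟩
    have h2 : γ ∈ ctx.idealOf (ctx.affineLift v) ↔
        -(ctx.affineLift v (-γ, ((1 : ℤ) : ℚ), 0)) ∈ ctx.PosHat := by
      rw [← e] at h1 ⊢
      exact ⟨fun h => h.2.2, fun h => ⟨hγ, h1, h⟩⟩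
    rw [h2, neg_affineLift_mem hv.1 hγ' hn']
    refine or_congr (by omega) ?_
    have h3 : 1 + -n = 0 ↔ n = 1 := by omega
    rw [h3]
    refine and_congr_right fun h => ?_
    subst h
    have h4 : -γ - ((-1 : ℤ) : ℚ) • ctx.θ = ctx.θ - γ := by
      push_cast
      module
    rw [h4]
  constructor
  · intro h
    have hγ := h.1
    obtain ⟨n, hn⟩ := pair_eq_int (mem_of_pos hγ) (θ_mem (ctx := ctx))
    rcases (key γ hγ n hn).1 h with h | ⟨rfl, h⟩
    · exact Or.inl (eq_θ_of_pair (mem_of_pos hγ) (by rw [hn]; exact_mod_cast h))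
    · by_cases hne : γ = ctx.θ
      · exact Or.inl hne
      · refine Or.inr ⟨hγ, (sub_θ_of_pos (mem_of_pos hγ) ?_ hne).2, h⟩
        rw [← pair_pos_iff θ_mem, hn]
        norm_num
  · rintro (rfl | ⟨hγ, h1, h2⟩)
    · exact (key _ ctx.θ_pos 2 (by rw [pair_self θ_mem]; norm_num)).2 (Or.inl (by norm_num))
    · refine (key γ hγ 1 ?_).2 (Or.inr ⟨rfl, h2⟩)
      have h3 := (sub_θ_of_pos (mem_of_pos h1) (hv.2.2 _ h1 h2) fun h =>
        ne_zero_of_mem (mem_of_pos hγ) (sub_eq_self.1 h)).1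
      rw [pair_sub, pair_self θ_mem] at h3
      push_cast
      linarith

variable (ctx) in
/-- the nonempty abelian ideals contained in `{γ ∈ Δ⁺ : (γ, θ) > 0}` -/
def IsSmallIdeal (I : Set V) : Prop :=
  I.Nonempty ∧ ctx.IsAbelianIdeal I ∧ I ⊆ {γ | γ ∈ ctx.Pos ∧ 0 < ctx.B γ ctx.θ}

theorem isSmallIdeal_idealOf {v : V ≃ₗ[ℚ] V} (hv : ctx.Adapted v) :
    ctx.IsSmallIdeal (ctx.idealOf (ctx.affineLift v)) := by
  refine ⟨⟨ctx.θ, (mem_idealOf_affineLift hv).2 (Or.inl rfl)⟩,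
    isAbelianIdeal_idealOf (isMinuscule_affineLift hv), fun γ hγ => ⟨hγ.1, ?_⟩⟩
  rcases (mem_idealOf_affineLift hv).1 hγ with rfl | ⟨h0, h1, h2⟩
  · exact B_self_pos θ_mem
  · have h3 := (sub_θ_of_pos (mem_of_pos h1) (hv.2.2 _ h1 h2) fun h =>
      ne_zero_of_mem (mem_of_pos h0) (sub_eq_self.1 h)).1
    rw [pair_sub, pair_self θ_mem] at h3
    rw [← pair_pos_iff θ_mem]
    linarith

theorem exists_adapted {I : Set V} (hI : ctx.IsSmallIdeal I) :
    ∃ v, ctx.Adapted v ∧ ctx.idealOf (ctx.affineLift v) = I := by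
  obtain ⟨hne, hab, hH⟩ := hI
  have hθ := θ_mem_of_ideal hne hab hH
  obtain ⟨v, hv, hiff⟩ := exists_weyl_of_ideal _ I rfl hne hab hH
  have had : ctx.Adapted v := by
    refine ⟨hv, ?_, fun γ hγ h => ?_⟩
    · by_contra h
      have h1 := (hiff _ ctx.θ_pos).1 ((neg_mem_pos_iff (weyl_mem hv θ_mem)).2 h)
      rw [sub_self] at h1
      exact ne_zero_of_mem (mem_of_pos (hab.1 h1)) rfl
    · refine lt_of_le_of_ne (B_θ_nonneg hγ) fun h0 => ?_
      have h1 := (hiff γ hγ).1 h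
      have h2 := eq_θ_of_pair (mem_of_pos (hab.1 h1)) (by
        rw [pair_sub, pair_self θ_mem, pair, ← h0]
        norm_num)
      exact ne_zero_of_mem (mem_of_pos hγ) (sub_eq_self.1 h2)
  refine ⟨v, had, Set.ext fun γ => ?_⟩
  rw [mem_idealOf_affineLift had]
  constructor
  · rintro (rfl | ⟨_, h1, h2⟩)
    · exact hθ
    · simpa using (hiff _ h1).1 h2
  · intro h
    by_cases hne : γ = ctx.θ
    · exact Or.inl hne
    · have h1 := (sub_θ_of_pos (mem_of_pos (hab.1 h)) (hH h).2 hne).2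
      exact Or.inr ⟨hab.1 h, h1, (hiff _ h1).2 (by simpa using h)⟩

theorem hasRootlet_affineLift {v : V ≃ₗ[ℚ] V} (hv : ctx.Adapted v) :
    ctx.HasRootlet (ctx.idealOf (ctx.affineLift v)) (v ctx.θ) :=
  ⟨_, isMinuscule_affineLift hv, rfl, affineLift_alpha0 v⟩

theorem HasRootlet.unique {I : Set V} {μ ν : V} (h₁ : ctx.HasRootlet I μ)
    (h₂ : ctx.HasRootlet I ν) : μ = ν := by
  obtain ⟨w₁, hw₁, hI₁, e₁⟩ := h₁
  obtain ⟨w₂, hw₂, hI₂, e₂⟩ := h₂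
  rw [minuscule_eq hw₁ hw₂ (hI₁.trans hI₂.symm), e₂] at e₁
  exact (congrArg Prod.fst e₁).symm

theorem Adapted.inv_mem_pos_iff {v : V ≃ₗ[ℚ] V} (hv : ctx.Adapted v) {η : V} (hη : η ∈ ctx.Pos) :
    v⁻¹ η ∈ ctx.Pos ↔ 0 ≤ ctx.B η (v ctx.θ) := by
  have hinv : v⁻¹ ∈ ctx.weyl := inv_mem hv.1
  have hmem := weyl_mem hinv (mem_of_pos hη)
  have e : v (v⁻¹ η) = η := by rw [← LinearEquiv.mul_apply, mul_inv_cancel]; rfl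
  have hB : ctx.B η (v ctx.θ) = ctx.B (v⁻¹ η) ctx.θ := by rw [← B_weyl hv.1 (v⁻¹ η), e]
  rw [hB]
  refine ⟨B_θ_nonneg, fun h => ?_⟩
  by_contra hn
  have h1 := hv.2.2 _ ((neg_mem_pos_iff hmem).2 hn) (by rwa [map_neg, neg_neg, e])
  rw [map_neg, LinearMap.neg_apply] at h1
  linarith

theorem Adapted.affineLift_eq {v₁ v₂ : V ≃ₗ[ℚ] V} (h₁ : ctx.Adapted v₁) (h₂ : ctx.Adapted v₂)
    (h : v₁ ctx.θ = v₂ ctx.θ) : ctx.affineLift v₁ = ctx.affineLift v₂ := by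
  have hu : v₁⁻¹ * v₂ ∈ ctx.weyl := mul_mem (inv_mem h₁.1) h₂.1
  have hpos : ∀ α ∈ ctx.Pos, (v₁⁻¹ * v₂) α ∈ ctx.Pos := by
    intro α hα
    have hmem := weyl_mem h₂.1 (mem_of_pos hα)
    have e : v₂⁻¹ (v₂ α) = α := by rw [← LinearEquiv.mul_apply, inv_mul_cancel]; rfl
    rw [LinearEquiv.mul_apply]
    by_cases hp : v₂ α ∈ ctx.Pos
    · rwa [h₁.inv_mem_pos_iff hp, h, ← h₂.inv_mem_pos_iff hp, e]
    · have hp' := (neg_mem_pos_iff hmem).2 hp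
      have h3 := weyl_mem (inv_mem h₁.1) hmem
      by_contra hn
      have h4 := (neg_mem_pos_iff h3).2 hn
      rw [← map_neg, h₁.inv_mem_pos_iff hp', h, ← h₂.inv_mem_pos_iff hp', map_neg, e] at h4
      exact ctx.pos_not_neg α hα h4
  have h1 : lift (v₁⁻¹ * v₂) = 1 := by
    refine eq_one_of_PosHat (lift_mem_What hu) fun β hβ => ?_
    obtain ⟨α, hα, k, rfl⟩ := PosHat_subset hβ
    rw [lift_mk, mk_mem_PosHat]
    exact ⟨weyl_mem hu hα, (mk_mem_PosHat.1 hβ).2.imp_right fun h => ⟨h.1, hpos α h.2⟩⟩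
  rw [map_mul, map_inv, inv_mul_eq_one] at h1
  rw [affineLift, affineLift, h1]

theorem exists_rootlet {I : Set V} (hI : ctx.IsSmallIdeal I) :
    ∃ μ ∈ ctx.PosLong, ctx.HasRootlet I μ := by
  obtain ⟨v, hv, rfl⟩ := exists_adapted hI
  exact ⟨v ctx.θ, ⟨hv.2.1, B_weyl hv.1 _ _⟩, hasRootlet_affineLift hv⟩

theorem exists_ideal {μ : V} (hμ : μ ∈ ctx.PosLong) :
    ∃ I, ctx.IsSmallIdeal I ∧ ctx.HasRootlet I μ := by
  obtain ⟨v, hv, rfl, h⟩ := exists_weyl_of_long _ μ (mem_of_pos hμ.1) hμ.2 (Nat.le_ceil _)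
  have had : ctx.Adapted v := ⟨hv, hμ.1, h⟩
  exact ⟨_, isSmallIdeal_idealOf had, hasRootlet_affineLift had⟩

theorem ideal_unique {I J : Set V} {μ : V} (hI : ctx.IsSmallIdeal I) (hJ : ctx.IsSmallIdeal J)
    (h₁ : ctx.HasRootlet I μ) (h₂ : ctx.HasRootlet J μ) : I = J := by
  obtain ⟨v₁, hv₁, rfl⟩ := exists_adapted hI
  obtain ⟨v₂, hv₂, rfl⟩ := exists_adapted hJ
  rw [hv₁.affineLift_eq hv₂]
  exact ((hasRootlet_affineLift hv₁).unique h₁).trans ((hasRootlet_affineLift hv₂).unique h₂).symm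

end RootSystemCtx

/-- Corollary to Theorem `H`: the rootlet map is a bijection
from the nonempty abelian ideals contained in `H = {γ ∈ Δ⁺ : (γ,θ) > 0}` onto
`Δ⁺_l`; in particular there are exactly `#(Δ⁺_l)` such ideals. -/
theorem statement_17 {V : Type*} [AddCommGroup V] [Module ℚ V] (ctx : RootSystemCtx V) :
    (∀ I : Set V, I.Nonempty → ctx.IsAbelianIdeal I →
        I ⊆ {γ | γ ∈ ctx.Pos ∧ 0 < ctx.B γ ctx.θ} →
        ∃ μ ∈ ctx.PosLong, ctx.HasRootlet I μ) ∧
    (∀ μ ∈ ctx.PosLong, ∃! I : Set V, I.Nonempty ∧ ctx.IsAbelianIdeal I ∧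
        I ⊆ {γ | γ ∈ ctx.Pos ∧ 0 < ctx.B γ ctx.θ} ∧ ctx.HasRootlet I μ) ∧
    {I : Set V | I.Nonempty ∧ ctx.IsAbelianIdeal I ∧
        I ⊆ {γ | γ ∈ ctx.Pos ∧ 0 < ctx.B γ ctx.θ}}.ncard = ctx.PosLong.ncard := by
  refine ⟨fun I hne hI hH => RootSystemCtx.exists_rootlet ⟨hne, hI, hH⟩, fun μ hμ => ?_, ?_⟩
  · obtain ⟨I, ⟨hne, hI, hH⟩, hr⟩ := RootSystemCtx.exists_ideal hμ
    exact ⟨I, ⟨hne, hI, hH, hr⟩, fun J hJ => RootSystemCtx.ideal_unique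
      ⟨hJ.1, hJ.2.1, hJ.2.2.1⟩ ⟨hne, hI, hH⟩ hJ.2.2.2 hr⟩
  · choose! f hf hr using fun I (hI : ctx.IsSmallIdeal I) => RootSystemCtx.exists_rootlet hI
    refine Set.ncard_congr (fun I _ => f I) (fun I hI => hf I hI) (fun I J hI hJ h => ?_)
      fun μ hμ => ?_
    · exact RootSystemCtx.ideal_unique hI hJ (hr I hI) (h ▸ hr J hJ)
    · obtain ⟨I, hI, hIμ⟩ := RootSystemCtx.exists_ideal hμ
      exact ⟨I, hI, (hr I hI).unique hIμ⟩
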